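/- arXiv:2605.20564 — 3 statements merged into one kernel-verified Lean document; each statement's English description precedes it below -/
import Mathlib

section
/- For every κ₀ ∈ 𝔠, every subgroup G of Thompson's group V that is isomorphic to ℤ × ℤ contains a non-identity element g with g(κ₀) = κ₀. -/
/-- Cantor space `{0,1}^ℕ`. -/
abbrev Cantor : Type := ℕ → Bool

/-- Concatenation of a finite binary word with an element of Cantor space. -/
def capp (w : List Bool) (κ : Cantor) : Cantor :=
  fun n => if h : n < w.length then w.get ⟨n, h⟩ else κ (n - w.length)

/-- Membership in Thompson's group `V`: a permutation of Cantor space is in `V` if it is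
locally given by prefix replacements. -/
def InV (h : Equiv.Perm Cantor) : Prop :=
  ∀ κ : Cantor, ∃ w u : List Bool,
    (∀ i : Fin w.length, κ i = w.get i) ∧
    ∀ κ' : Cantor, h (capp w κ') = capp u κ'

namespace ZV

open Finset

/-- The shift map. -/
def sh (κ : Cantor) : Cantor := fun n => κ (n + 1)

def cc (b : Bool) (κ : Cantor) : Cantor := fun n => Nat.casesOn n b κ

theorem sh_cc (b : Bool) (κ : Cantor) : sh (cc b κ) = κ := rfl

theorem cc_sh (κ : Cantor) : κ = cc (κ 0) (sh κ) := by
  funext n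
  cases n <;> rfl

theorem eq_cc {y x : Cantor} (h : sh y = x) : y = cc false x ∨ y = cc true x := by
  subst h
  have := cc_sh y
  cases hb : y 0
  · left; rw [hb] at this; exact this
  · right; rw [hb] at this; exact this

theorem sh_iter (k : ℕ) (κ : Cantor) (n : ℕ) : (sh^[k] κ) n = κ (n + k) := by
  induction k generalizing n with
  | zero => rfl
  | succ k ih =>
    rw [Function.iterate_succ_apply']
    change (sh^[k] κ) (n + 1) = _
    rw [ih]; congr 1; omega

theorem sh_capp (w : List Bool) (κ : Cantor) : sh^[w.length] (capp w κ) = κ := by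
  funext n
  rw [sh_iter]
  simp [capp]

theorem capp_sh (w : List Bool) (κ : Cantor) (h : ∀ i : Fin w.length, κ i = w.get i) :
    capp w (sh^[w.length] κ) = κ := by
  funext n
  unfold capp
  split
  · rename_i hn
    exact (h ⟨n, hn⟩).symm
  · rename_i hn
    rw [sh_iter]; congr 1; omega

def Near (N : ℕ) (y z : Cantor) : Prop := ∃ p ≤ N, ∃ q ≤ N, sh^[p] y = sh^[q] z

theorem Near.symm {N : ℕ} {y z : Cantor} (h : Near N y z) : Near N z y := by
  obtain ⟨p, hp, q, hq, h⟩ := h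
  exact ⟨q, hq, p, hp, h.symm⟩

theorem Near.mono {N M : ℕ} (hNM : N ≤ M) {y z : Cantor} (h : Near N y z) : Near M y z := by
  obtain ⟨p, hp, q, hq, h⟩ := h
  exact ⟨p, hp.trans hNM, q, hq.trans hNM, h⟩

theorem inV_near (g : Equiv.Perm Cantor) (hg : InV g) : ∃ N, ∀ κ, Near N κ (g κ) := by
  have key : ∃ N, ∀ κ ∈ (Set.univ : Set Cantor), Near N κ (g κ) := by
    refine IsCompact.induction_on (p := fun S : Set Cantor => ∃ N, ∀ κ ∈ S, Near N κ (g κ))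
      isCompact_univ ⟨0, by simp⟩ ?_ ?_ ?_
    · rintro s t hst ⟨N, hN⟩
      exact ⟨N, fun κ hκ => hN κ (hst hκ)⟩
    · rintro s t ⟨N, hN⟩ ⟨M, hM⟩
      refine ⟨max N M, ?_⟩
      rintro κ (h | h)
      · exact (hN κ h).mono (le_max_left _ _)
      · exact (hM κ h).mono (le_max_right _ _)
    · intro κ _
      obtain ⟨w, u, hw, hu⟩ := hg κ
      refine ⟨{κ' : Cantor | ∀ i : Fin w.length, κ' i = w.get i}, ?_, max w.length u.length, ?_⟩
      · apply mem_nhdsWithin_of_mem_nhds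
        have hset : {κ' : Cantor | ∀ i : Fin w.length, κ' i = w.get i} =
            ⋂ i : Fin w.length, (fun κ' : Cantor => κ' (i : ℕ)) ⁻¹' {w.get i} := by
          ext κ'
          simp
        have ho : IsOpen {κ' : Cantor | ∀ i : Fin w.length, κ' i = w.get i} := by
          rw [hset]
          apply isOpen_iInter_of_finite
          intro i
          have hcont : Continuous (fun κ' : Cantor => κ' (i : ℕ)) := continuous_apply (i : ℕ)
          exact IsOpen.preimage hcont (isOpen_discrete _)
        exact ho.mem_nhds hw
      · intro κ' hκ'
        refine ⟨w.length, le_max_left _ _, u.length, le_max_right _ _, ?_⟩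
        have h := capp_sh w κ' hκ'
        conv_rhs => rw [← h, hu, sh_capp]
  obtain ⟨N, hN⟩ := key
  exact ⟨N, fun κ => hN κ trivial⟩

open Classical in
noncomputable def pre : ℕ → Cantor → Finset Cantor
  | 0, _ => ∅
  | N + 1, x => insert x (pre N (cc false x) ∪ pre N (cc true x))

theorem pre_card (N : ℕ) (x : Cantor) : (pre N x).card + 1 ≤ 2 ^ N := by
  classical
  induction N generalizing x with
  | zero => simp [pre]
  | succ N ih =>
    have h1 := ih (cc false x)
    have h2 := ih (cc true x)
    have h3 := card_insert_le x (pre N (cc false x) ∪ pre N (cc true x))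
    have h4 := card_union_le (pre N (cc false x)) (pre N (cc true x))
    rw [pow_succ]
    have h5 : (pre (N + 1) x).card = (insert x (pre N (cc false x) ∪ pre N (cc true x))).card := by
      simp only [pre]
    omega

theorem mem_pre {N : ℕ} {x y : Cantor} {k : ℕ} (hk : k < N) (h : sh^[k] y = x) :
    y ∈ pre N x := by
  classical
  induction N generalizing x k with
  | zero => omega
  | succ N ih =>
    simp only [pre, mem_insert, mem_union]
    cases k with
    | zero => left; exact h
    | succ k =>
      rw [Function.iterate_succ_apply'] at h
      right
      rcases eq_cc h with h | h
      · left; exact ih (by omega) h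
      · right; exact ih (by omega) h

/-- Descendants of `x` in the shift graph cut above `r`. -/
def D (r x y : Cantor) : Prop := ∃ k, sh^[k] y = x ∧ ∀ i < k, sh^[i] y ≠ r

theorem D_boundary {N : ℕ} {r x y z : Cantor} (hn : Near N y z) (hy : D r x y)
    (hz : ¬ D r x z) : y ∈ pre N x ∨ z ∈ pre N r := by
  obtain ⟨p, hp, q, hq, h⟩ := hn
  obtain ⟨k, hk, hki⟩ := hy
  by_cases hpk : k < p
  · left; exact mem_pre (lt_of_lt_of_le hpk hp) hk
  · right
    by_contra hcon
    apply hz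
    refine ⟨(k - p) + q, ?_, ?_⟩
    · rw [Function.iterate_add_apply, ← h, ← Function.iterate_add_apply, Nat.sub_add_cancel (by omega)]
      exact hk
    · intro i hi hir
      by_cases hiq : i < q
      · exact hcon (mem_pre (lt_of_lt_of_le hiq hq) hir)
      · apply hki (i - q + p) (by omega)
        rw [Function.iterate_add_apply, h, ← Function.iterate_add_apply, Nat.sub_add_cancel (by omega)]
        exact hir

theorem line_const {P : ℕ → Prop} {n : ℕ} (h : ∀ j, j + 1 < n → (P j ↔ P (j + 1))) :
    ∀ j < n, (P j ↔ P 0) := by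
  intro j
  induction j with
  | zero => intro _; rfl
  | succ j ih => intro hj; rw [← h j hj]; exact ih (by omega)

open Classical in
theorem grid (Q : ℕ → ℕ → Prop) (n C : ℕ) (R K : Finset ℕ) (hCn : C < n)
    (hR : R.card ≤ C) (hK : K.card ≤ C)
    (hrow : ∀ i < n, i ∉ R → ∀ j, j + 1 < n → (Q i j ↔ Q i (j + 1)))
    (hcol : ∀ j < n, j ∉ K → ∀ i, i + 1 < n → (Q i j ↔ Q (i + 1) j)) :
    ((range n ×ˢ range n).filter (fun p => Q p.1 p.2)).card ≤ n * C ∨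
    n * (n - C) ≤ ((range n ×ˢ range n).filter (fun p => Q p.1 p.2)).card := by
  obtain ⟨i0, hi0, hi0R⟩ : ∃ i ∈ range n, i ∉ R := by
    apply exists_mem_notMem_of_card_lt_card
    simpa using lt_of_le_of_lt hR hCn
  rw [mem_range] at hi0
  have hr := line_const (hrow i0 hi0 hi0R)
  have hc : ∀ j < n, j ∉ K → ∀ i < n, (Q i j ↔ Q i0 0) := by
    intro j hj hjK i hi
    have h := line_const (P := fun i => Q i j) (hcol j hj hjK)
    exact ((h i hi).trans (h i0 hi0).symm).trans (hr j hj)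
  by_cases hq : Q i0 0
  · right
    have hsub : range n ×ˢ (range n \ K) ⊆ (range n ×ˢ range n).filter (fun p => Q p.1 p.2) := by
      rintro ⟨i, j⟩ hp
      simp only [mem_product, mem_sdiff, mem_range, mem_filter] at hp ⊢
      exact ⟨⟨hp.1, hp.2.1⟩, (hc j hp.2.1 hp.2.2 i hp.1).2 hq⟩
    have h1 := card_le_card hsub
    rw [card_product, card_range] at h1
    have h2 := le_card_sdiff K (range n)
    rw [card_range] at h2
    exact (Nat.mul_le_mul_left n (by omega)).trans h1
  · left
    have hsub : (range n ×ˢ range n).filter (fun p => Q p.1 p.2) ⊆ range n ×ˢ K := by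
      rintro ⟨i, j⟩ hp
      simp only [mem_product, mem_range, mem_filter] at hp ⊢
      refine ⟨hp.1.1, ?_⟩
      by_contra hjK
      exact hq ((hc j hp.1.2 hjK i hp.1.1).1 hp.2)
    have h1 := card_le_card hsub
    rw [card_product, card_range] at h1
    exact h1.trans (Nat.mul_le_mul_left n hK)

theorem ancestor (f : ℕ × ℕ → Cantor) (N : ℕ)
    (h1 : ∀ i j, Near N (f (i, j)) (f (i + 1, j)))
    (h2 : ∀ i j, Near N (f (i, j)) (f (i, j + 1))) (F : Finset (ℕ × ℕ)) :
    ∃ r, ∀ p ∈ F, ∃ k, sh^[k] (f p) = r := by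
  have trans : ∀ x y z : Cantor, (∃ k l, sh^[k] x = sh^[l] y) → (∃ k l, sh^[k] y = sh^[l] z) →
      ∃ k l, sh^[k] x = sh^[l] z := by
    rintro x y z ⟨k, l, h⟩ ⟨k', l', h'⟩
    refine ⟨k' + k, l + l', ?_⟩
    rw [Function.iterate_add_apply, h, ← Function.iterate_add_apply, add_comm k' l,
      Function.iterate_add_apply, h', ← Function.iterate_add_apply]
  have near : ∀ x y, Near N x y → ∃ k l, sh^[k] y = sh^[l] x := by
    rintro x y ⟨p, _, q, _, h⟩
    exact ⟨q, p, h.symm⟩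
  have hA : ∀ i, ∃ k l, sh^[k] (f (i, 0)) = sh^[l] (f (0, 0)) := by
    intro i
    induction i with
    | zero => exact ⟨0, 0, rfl⟩
    | succ i ih => exact trans _ _ _ (near _ _ (h1 i 0)) ih
  have hB : ∀ i j, ∃ k l, sh^[k] (f (i, j)) = sh^[l] (f (0, 0)) := by
    intro i j
    induction j with
    | zero => exact hA i
    | succ j ih => exact trans _ _ _ (near _ _ (h2 i j)) ih
  choose k l hkl using hB
  refine ⟨sh^[F.sup (fun p => l p.1 p.2)] (f (0, 0)), fun p hp => ?_⟩
  have hle : l p.1 p.2 ≤ F.sup (fun p => l p.1 p.2) := le_sup (f := fun p : ℕ × ℕ => l p.1 p.2) hp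
  refine ⟨(F.sup (fun p => l p.1 p.2) - l p.1 p.2) + k p.1 p.2, ?_⟩
  rw [Function.iterate_add_apply]
  have := hkl p.1 p.2
  rw [Prod.mk.eta] at this
  rw [this, ← Function.iterate_add_apply, Nat.sub_add_cancel hle]

open Classical in
theorem descent (f : ℕ × ℕ → Cantor) (hf : Function.Injective f) (F : Finset (ℕ × ℕ))
    (r : Cantor) (hr : ∀ p ∈ F, ∃ k, sh^[k] (f p) = r) (m : ℕ) (hm : 1 ≤ m) (hmF : m ≤ F.card) :
    ∃ x, m ≤ (F.filter (fun p => D r x (f p))).card ∧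
      (F.filter (fun p => D r x (f p))).card ≤ 2 * m - 1 := by
  let P : ℕ → Prop := fun d => ∃ x, sh^[d] x = r ∧ (∀ i < d, sh^[i] x ≠ r) ∧
    m ≤ (F.filter (fun p => D r x (f p))).card
  have hP0 : P 0 := by
    refine ⟨r, rfl, by simp, ?_⟩
    rw [filter_true_of_mem]
    · exact hmF
    · intro p hp
      exact ⟨Nat.find (hr p hp), Nat.find_spec (hr p hp), fun i hi => Nat.find_min (hr p hp) hi⟩
  have hbd : ∃ M, ∀ d, P d → d ≤ M := by
    have : ∀ p, ∃ k, p ∈ F → sh^[k] (f p) = r := by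
      intro p
      by_cases hp : p ∈ F
      · obtain ⟨k, hk⟩ := hr p hp
        exact ⟨k, fun _ => hk⟩
      · exact ⟨0, fun h => absurd h hp⟩
    choose K hK using this
    refine ⟨F.sup K, ?_⟩
    rintro d ⟨x, hx, hxi, hc⟩
    obtain ⟨p, hp⟩ := card_pos.1 (lt_of_lt_of_le (by omega) hc)
    rw [mem_filter] at hp
    obtain ⟨hpF, k, hk, hki⟩ := hp
    refine le_trans ?_ (le_sup (f := K) hpF)
    by_contra hlt
    have hKp := hK p hpF
    by_cases h : K p < k
    · exact hki _ h hKp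
    · apply hxi (K p - k) (by omega)
      rw [← hk, ← Function.iterate_add_apply, Nat.sub_add_cancel (by omega)]
      exact hKp
  obtain ⟨d, hd, hd1⟩ : ∃ d, P d ∧ ¬ P (d + 1) := by
    by_contra hcon
    push Not at hcon
    have hall : ∀ d, P d := fun d => Nat.rec hP0 (fun d ih => hcon d ih) d
    obtain ⟨M, hM⟩ := hbd
    have := hM _ (hall (M + 1))
    omega
  obtain ⟨x, hx, hxi, hc⟩ := hd
  refine ⟨x, hc, ?_⟩
  let E : Cantor → Finset (ℕ × ℕ) := fun c => if c = r then ∅ else F.filter (fun p => D r c (f p))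
  have hE : ∀ b, (E (cc b x)).card ≤ m - 1 := by
    intro b
    by_cases hb : cc b x = r
    · simp [E, hb]
    · simp only [E, if_neg hb]
      by_contra hlt
      apply hd1
      refine ⟨cc b x, ?_, ?_, by omega⟩
      · rw [Function.iterate_succ_apply, sh_cc, hx]
      · intro i hi
        cases i with
        | zero => exact hb
        | succ i =>
          rw [Function.iterate_succ_apply, sh_cc]
          exact hxi i (by omega)
  have hsub : F.filter (fun p => D r x (f p)) ⊆
      (F.filter (fun p => f p = x)) ∪ (E (cc false x) ∪ E (cc true x)) := by
    intro p hp
    rw [mem_filter] at hp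
    obtain ⟨hpF, k, hk, hki⟩ := hp
    rw [mem_union, mem_union]
    cases k with
    | zero => left; rw [mem_filter]; exact ⟨hpF, hk⟩
    | succ k =>
      right
      have hne := hki k (by omega)
      rw [Function.iterate_succ_apply'] at hk
      have aux : ∀ c, sh^[k] (f p) = c → p ∈ E c := by
        intro c h
        have : c ≠ r := h ▸ hne
        simp only [E, if_neg this, mem_filter]
        exact ⟨hpF, k, h, fun i hi => hki i (by omega)⟩
      rcases eq_cc hk with h | h
      · left; exact aux _ h
      · right; exact aux _ h
  have h1 : (F.filter (fun p => f p = x)).card ≤ 1 := by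
    rw [card_le_one]
    intro p hp q hq
    rw [mem_filter] at hp hq
    exact hf (hp.2.trans hq.2.symm)
  have h2 := card_le_card hsub
  have h3 := card_union_le (F.filter (fun p => f p = x)) (E (cc false x) ∪ E (cc true x))
  have h4 := card_union_le (E (cc false x)) (E (cc true x))
  have h5 := hE false
  have h6 := hE true
  omega

theorem no_grid (f : ℕ × ℕ → Cantor) (hf : Function.Injective f) (N : ℕ)
    (h1 : ∀ i j, Near N (f (i, j)) (f (i + 1, j)))
    (h2 : ∀ i j, Near N (f (i, j)) (f (i, j + 1))) : False := by
  classical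
  obtain ⟨C, hC⟩ : ∃ C, C = 2 ^ N + 2 ^ N := ⟨_, rfl⟩
  have hC1 : 1 ≤ C := by have := Nat.pos_of_ne_zero (pow_ne_zero N (two_ne_zero (α := ℕ))); omega
  obtain ⟨n, hn⟩ : ∃ n, n = 3 * C + 1 := ⟨_, rfl⟩
  let F := range n ×ˢ range n
  obtain ⟨r, hr⟩ := ancestor f N h1 h2 F
  obtain ⟨x, hx1, hx2⟩ := descent f hf F r hr (n * C + 1) (by omega) (by
    simp only [F, card_product, card_range]
    subst hn; nlinarith)
  let B := pre N x ∪ pre N r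
  have hB : B.card ≤ C := by
    have h3 := card_union_le (pre N x) (pre N r)
    have h4 := pre_card N x
    have h5 := pre_card N r
    simp only [B]
    omega
  let G := F.filter (fun p => f p ∈ B)
  have hG : G.card ≤ C := by
    refine le_trans (card_le_card_of_injOn f ?_ hf.injOn) hB
    intro p hp
    exact (mem_filter.1 hp).2
  have hbd : ∀ p ∈ F, ∀ q ∈ F, Near N (f p) (f q) → p ∉ G → q ∉ G →
      (D r x (f p) ↔ D r x (f q)) := by
    intro p hp q hq hpq hpG hqG
    have hpB : f p ∉ B := fun h => hpG (mem_filter.2 ⟨hp, h⟩)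
    have hqB : f q ∉ B := fun h => hqG (mem_filter.2 ⟨hq, h⟩)
    simp only [B, mem_union, not_or] at hpB hqB
    constructor
    · intro h
      by_contra h'
      rcases D_boundary hpq h h' with h | h
      · exact hpB.1 h
      · exact hqB.2 h
    · intro h
      by_contra h'
      rcases D_boundary hpq.symm h h' with h | h
      · exact hqB.1 h
      · exact hpB.2 h
  have hmem : ∀ i j, i < n → j < n → (i, j) ∈ F := by
    intro i j hi hj
    simp [F, hi, hj]
  have := grid (fun i j => D r x (f (i, j))) n C (G.image Prod.fst) (G.image Prod.snd) (by omega)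
    (card_image_le.trans hG) (card_image_le.trans hG)
    (by
      intro i hi hiR j hj
      exact hbd _ (hmem _ _ hi (by omega)) _ (hmem _ _ hi hj) (h2 i j)
        (fun h => hiR (mem_image_of_mem Prod.fst h)) (fun h => hiR (mem_image_of_mem Prod.fst h)))
    (by
      intro j hj hjK i hi
      exact hbd _ (hmem _ _ (by omega) hj) _ (hmem _ _ hi hj) (h1 i j)
        (fun h => hjK (mem_image_of_mem Prod.snd h)) (fun h => hjK (mem_image_of_mem Prod.snd h)))
  simp only [Prod.mk.eta] at this
  change (F.filter (fun p => D r x (f p))).card ≤ _ ∨ _ ≤ (F.filter (fun p => D r x (f p))).card at this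
  rcases this with h | h
  · omega
  · have h3 : n - C = 2 * C + 1 := by omega
    rw [h3] at h
    have h4 : n * (2 * C + 1) = 2 * (n * C) + n := by ring
    omega

end ZV

/-- **Corollary.** Every subgroup of Thompson's group `V` isomorphic to `ℤ²` intersects
the stabilizer of each point of Cantor space non-trivially. -/
theorem Z2_in_V_has_fixed_point (κ₀ : Cantor) (G : Subgroup (Equiv.Perm Cantor))
    (hGV : ∀ g ∈ G, InV g)
    (hiso : Nonempty (↥G ≃* Multiplicative (ℤ × ℤ))) :
    ∃ g ∈ G, g ≠ 1 ∧ g κ₀ = κ₀ := by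
  by_contra hcon
  push Not at hcon
  obtain ⟨e⟩ := hiso
  let T : ℤ × ℤ → Equiv.Perm Cantor := fun v => (e.symm (Multiplicative.ofAdd v) : G)
  have hTG : ∀ v, T v ∈ G := fun v => (e.symm (Multiplicative.ofAdd v)).2
  have hTadd : ∀ v w, T (v + w) = T v * T w := by
    intro v w
    simp [T, ofAdd_add]
  have hT1 : ∀ v, T v = 1 → v = 0 := by
    intro v hv
    have h1 : e.symm (Multiplicative.ofAdd v) = 1 := Subtype.ext hv
    simpa using h1
  have hinj : ∀ v w, T v κ₀ = T w κ₀ → v = w := by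
    intro v w h
    have h0 : T v = T w * T (v - w) := by rw [← hTadd]; congr 1; abel
    rw [h0, Equiv.Perm.mul_apply] at h
    have h1 := (T w).injective h
    by_contra hne
    refine hcon (T (v - w)) (hTG _) (fun h2 => hne (sub_eq_zero.1 (hT1 _ h2))) h1
  obtain ⟨N, hN⟩ := ZV.inV_near _ (hGV _ (hTG (1, 0)))
  obtain ⟨M, hM⟩ := ZV.inV_near _ (hGV _ (hTG (0, 1)))
  refine ZV.no_grid (fun p => T ((p.1 : ℤ), (p.2 : ℤ)) κ₀) ?_ (max N M) ?_ ?_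
  · intro p q h
    have := hinj _ _ h
    simp only [Prod.mk.injEq, Nat.cast_inj] at this
    exact Prod.ext this.1 this.2
  · intro i j
    have h : T (((i + 1 : ℕ) : ℤ), (j : ℤ)) = T (1, 0) * T ((i : ℤ), (j : ℤ)) := by
      rw [← hTadd]; congr 1; ext <;> simp [add_comm]
    simp only [h, Equiv.Perm.mul_apply]
    exact (hN _).mono (le_max_left _ _)
  · intro i j
    have h : T ((i : ℤ), ((j + 1 : ℕ) : ℤ)) = T (0, 1) * T ((i : ℤ), (j : ℤ)) := by
      rw [← hTadd]; congr 1; ext <;> simp [add_comm]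
    simp only [h, Equiv.Perm.mul_apply]
    exact (hM _).mono (le_max_right _ _)
end

section
/- Let W be a group, B ≤ W a subgroup, and z ∈ W an element of infinite order such that W is generated by B ∪ {z} and such that for all integers n ≠ m, every element of z^n B z^{−n} commutes with every element of z^m B z^{−m} and z^n B z^{−n} ∩ z^m B z^{−m} = {1}. Let H ≤ W be a subgroup such that for every non-identity element w ∈ W the cyclic subgroup generated by w intersects H non-trivially. Then the commutator subgroup [B,B] is contained in H. -/
/-- **Lemma.** Let `W` be an internal regular wreath product with acting group `⟨z⟩ ≅ ℤ`
and base group `B`. If `H ≤ W` meets every non-trivial cyclic subgroup of `W`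
non-trivially, then `[B,B] ≤ H`. -/
theorem commutator_le_of_meets_cyclics {W : Type*} [Group W]
    (B : Subgroup W) (z : W) (hz : ¬ IsOfFinOrder z)
    (hgen : Subgroup.closure ({z} ∪ (B : Set W)) = ⊤)
    (hcomm : ∀ n m : ℤ, n ≠ m → ∀ b ∈ B, ∀ b' ∈ B,
      Commute (z ^ n * b * z ^ (-n)) (z ^ m * b' * z ^ (-m)))
    (hdisj : ∀ n m : ℤ, n ≠ m → ∀ b ∈ B, ∀ b' ∈ B,
      z ^ n * b * z ^ (-n) = z ^ m * b' * z ^ (-m) → z ^ n * b * z ^ (-n) = 1)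
    (H : Subgroup W)
    (hH : ∀ w : W, w ≠ 1 → ∃ k : ℤ, w ^ k ≠ 1 ∧ w ^ k ∈ H) :
    ⁅B, B⁆ ≤ H := by
  have hz1 : z ≠ 1 := by
    rintro rfl
    exact hz IsOfFinOrder.one
  have key : ∀ g : W, ∃ k : ℤ, k ≠ 0 ∧ g * z ^ k * g⁻¹ ∈ H := by
    intro g
    obtain ⟨k, hk, hkH⟩ := hH (g * z * g⁻¹) (by
      intro h
      exact hz1 (conj_eq_one_iff.mp h))
    refine ⟨k, ?_, ?_⟩
    · rintro rfl
      exact hk (zpow_zero _)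
    · rwa [conj_zpow] at hkH
  have lift : ∀ (g : W) (k l : ℤ), g * z ^ k * g⁻¹ ∈ H → g * z ^ (k * l) * g⁻¹ ∈ H := by
    intro g k l h
    have := H.zpow_mem h l
    rwa [conj_zpow, ← zpow_mul] at this
  rw [Subgroup.commutator_le]
  intro a ha b hb
  obtain ⟨k₁, h₁, hk₁⟩ := key 1
  obtain ⟨k₂, h₂, hk₂⟩ := key a
  obtain ⟨k₃, h₃, hk₃⟩ := key b
  obtain ⟨k, hk, hz', ha', hb'⟩ : ∃ k : ℤ, k ≠ 0 ∧ z ^ k ∈ H ∧ a * z ^ k * a⁻¹ ∈ H ∧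
      b * z ^ k * b⁻¹ ∈ H := by
    refine ⟨k₁ * k₂ * k₃, by positivity, ?_, ?_, ?_⟩
    · have := lift 1 k₁ (k₂ * k₃) hk₁
      rw [← mul_assoc] at this
      simpa using this
    · have := lift a k₂ (k₁ * k₃) hk₂
      rwa [show k₂ * (k₁ * k₃) = k₁ * k₂ * k₃ by ring] at this
    · have := lift b k₃ (k₁ * k₂) hk₃
      rwa [show k₃ * (k₁ * k₂) = k₁ * k₂ * k₃ by ring] at this
  have hx : a * (z ^ k * a⁻¹ * z ^ (-k)) ∈ H := by
    have := H.mul_mem ha' (H.inv_mem hz')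
    rw [← zpow_neg] at this
    simpa only [mul_assoc] using this
  have hy : b * (z ^ (-k) * b⁻¹ * z ^ (- -k)) ∈ H := by
    have := H.mul_mem (H.inv_mem hb') hz'
    rw [show (b * z ^ k * b⁻¹)⁻¹ * z ^ k = b * (z ^ (-k) * b⁻¹ * z ^ (- -k)) by group] at this
    exact this
  have c1 := hcomm k (-k) (by omega) a⁻¹ (B.inv_mem ha) b⁻¹ (B.inv_mem hb)
  have c2 := hcomm k 0 hk a⁻¹ (B.inv_mem ha) b hb
  have c3 := hcomm (-k) 0 (by omega) b⁻¹ (B.inv_mem hb) a ha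
  simp only [neg_zero, zpow_zero, one_mul, mul_one] at c2 c3
  generalize z ^ k * a⁻¹ * z ^ (-k) = x at *
  generalize z ^ (-k) * b⁻¹ * z ^ (- -k) = y at *
  have e : a * x * (b * y) * (a * x)⁻¹ * (b * y)⁻¹ = a * b * a⁻¹ * b⁻¹ := by
    have e1 : x * (b * y) * x⁻¹ = b * y := by
      rw [(c2.mul_right c1).eq, mul_inv_cancel_right]
    have e2 : y * a⁻¹ * y⁻¹ = a⁻¹ := by
      rw [c3.inv_right.eq, mul_inv_cancel_right]
    calc a * x * (b * y) * (a * x)⁻¹ * (b * y)⁻¹ = a * (x * (b * y) * x⁻¹) * a⁻¹ * y⁻¹ * b⁻¹ := by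
          group
      _ = a * b * (y * a⁻¹ * y⁻¹) * b⁻¹ := by rw [e1]; group
      _ = a * b * a⁻¹ * b⁻¹ := by rw [e2]
  rw [commutatorElement_def, ← e]
  exact H.mul_mem (H.mul_mem (H.mul_mem hx hy) (H.inv_mem hx)) (H.inv_mem hy)
end

section
/- Let n ≥ 2 and let F_n be the Brown–Higman–Thompson group. Let Y = (0,1) ∪ {∞} be the one-point compactification of the open interval (0,1), on which F_n acts by extending its action on (0,1) and fixing ∞. Then for every injective group homomorphism ι : F_n → V into Thompson's group V, the action of F_n on 𝔠 via ι is semiconjugate to this standard action: there exists a continuous surjection φ : 𝔠 → Y such that φ(ι(f)(κ)) = f̂(φ(κ)) for all f ∈ F_n and κ ∈ 𝔠, where f̂ : Y → Y is the extension of f fixing ∞. -/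
/-- `f` is an element of the Bieri–Strebel group `F([p,q];A,P)`, realized as a
permutation of `ℝ` supported on `[p,q]`: it is an orientation-preserving piecewise-linear
homeomorphism of `[p,q]` (extended by the identity), with finitely many breakpoints, all
breakpoints in `A` and all slopes in `P`. -/
def IsBS (p q : ℝ) (A P : Set ℝ) (f : Equiv.Perm ℝ) : Prop :=
  Monotone ⇑f ∧ (∀ x : ℝ, x ∉ Set.Icc p q → f x = x) ∧
  ∃ (n : ℕ) (t : ℕ → ℝ), t 0 = p ∧ t n = q ∧ (∀ i : ℕ, i < n → t i < t (i + 1)) ∧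
    (∀ i : ℕ, 0 < i → i < n → t i ∈ A) ∧
    (∀ i : ℕ, i < n → ∃ c ∈ P, ∀ x ∈ Set.Icc (t i) (t (i + 1)),
      f x = f (t i) + c * (x - t i))

/-- The ring `ℤ[1/n]` inside `ℝ`. -/
def dyadicLike (n : ℕ) : Set ℝ := {x : ℝ | ∃ (z : ℤ) (k : ℕ), x = (z : ℝ) / (n : ℝ) ^ k}

/-- The set of integer powers of `n` in `ℝ`. -/
def powersOf (n : ℕ) : Set ℝ := {x : ℝ | ∃ k : ℤ, x = (n : ℝ) ^ k}

namespace FnV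

open Set Filter Topology

lemma capp_lt (w : List Bool) (τ : Cantor) (i : ℕ) (h : i < w.length) :
    capp w τ i = w[i] := by
  simp [capp, h]

lemma capp_ge (w : List Bool) (τ : Cantor) (i : ℕ) (h : w.length ≤ i) :
    capp w τ i = τ (i - w.length) := by
  simp [capp, not_lt.mpr h]

lemma capp_append (a b : List Bool) (τ : Cantor) :
    capp (a ++ b) τ = capp a (capp b τ) := by
  funext i
  by_cases h1 : i < a.length
  · rw [capp_lt _ _ _ (by simp; omega), capp_lt _ _ _ h1, List.getElem_append_left h1]
  · rw [capp_ge a _ _ (by omega)]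
    by_cases h2 : i < (a ++ b).length
    · have h3 : i - a.length < b.length := by simp at h2; omega
      rw [capp_lt _ _ _ h2, capp_lt _ _ _ h3, List.getElem_append_right (by omega)]
    · have h2' : ¬ i < a.length + b.length := by simpa using h2
      rw [capp_ge _ _ _ (by simpa using h2), capp_ge _ _ _ (by omega)]
      congr 1
      simp; omega

lemma capp_comparable {a b : List Bool} {τ τ' : Cantor} (h : capp a τ = capp b τ')
    (hl : a.length ≤ b.length) : ∃ y, b = a ++ y := by
  refine ⟨b.drop a.length, ?_⟩
  have : a = b.take a.length := by
    apply List.ext_getElem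
    · simp [hl]
    · intro i h1 h2
      have h3 := congrFun h i
      rw [capp_lt _ _ _ h1, capp_lt _ _ _ (by omega)] at h3
      simp [h3]
  conv_lhs => rw [← List.take_append_drop a.length b, ← this]

lemma capp_right_inj {a : List Bool} {τ τ' : Cantor} (h : capp a τ = capp a τ') : τ = τ' := by
  funext i
  have := congrFun h (i + a.length)
  rw [capp_ge _ _ _ (by omega), capp_ge _ _ _ (by omega)] at this
  simpa using this

lemma append_eq_nil_of_capp {a y : List Bool} (h : ∀ τ, capp a τ = capp (a ++ y) τ) : y = [] := by
  rcases y with _ | ⟨c, y⟩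
  · rfl
  · exfalso
    have h1 := h (fun _ => !c)
    rw [capp_append] at h1
    have h2 := congrFun (capp_right_inj h1) 0
    rw [capp_lt _ _ _ (by simp)] at h2
    simp at h2

lemma capp_left_inj {a b : List Bool} (h : ∀ τ, capp a τ = capp b τ) : a = b := by
  rcases le_total a.length b.length with hl | hl
  · obtain ⟨y, rfl⟩ := capp_comparable (h (fun _ => true)) hl
    simp [append_eq_nil_of_capp h]
  · obtain ⟨y, rfl⟩ := capp_comparable (h (fun _ => true)).symm hl
    simp [append_eq_nil_of_capp (fun τ => (h τ).symm)]

/-- initial word of length `N` -/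
def pre (N : ℕ) (x : Cantor) : List Bool := List.ofFn (fun i : Fin N => x i)

@[simp] lemma pre_length (N : ℕ) (x : Cantor) : (pre N x).length = N := by simp [pre]

lemma capp_pre (N : ℕ) (x : Cantor) : capp (pre N x) (fun i => x (i + N)) = x := by
  funext i
  by_cases h : i < N
  · rw [capp_lt _ _ _ (by simpa using h)]; simp [pre]
  · rw [capp_ge _ _ _ (by simpa using h)]; simp; congr 1; omega

lemma pre_capp (w : List Bool) (τ : Cantor) : pre w.length (capp w τ) = w := by
  apply List.ext_getElem
  · simp
  · intro i h1 h2
    simp [pre, capp_lt _ _ _ h2]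

lemma pre_eq_iff {N : ℕ} {x y : Cantor} : pre N x = pre N y ↔ ∀ i < N, x i = y i := by
  unfold pre
  rw [List.ofFn_inj]
  constructor
  · intro h i hi
    exact congrFun h ⟨i, hi⟩
  · intro h
    funext i
    exact h i i.2

lemma pre_mem_nhds (N : ℕ) (x : Cantor) : {y | pre N y = pre N x} ∈ 𝓝 x := by
  have h : Continuous (fun y : Cantor => (fun i : Fin N => y i)) := by fun_prop
  have h2 : IsOpen ({fun i : Fin N => x i} : Set (Fin N → Bool)) := isOpen_discrete _
  have h3 := (h2.preimage h).mem_nhds (x := x) (by simp)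
  filter_upwards [h3] with y hy
  unfold pre
  rw [List.ofFn_inj]
  exact hy

lemma exists_pre_subset {x : Cantor} {U : Set Cantor} (hU : U ∈ 𝓝 x) :
    ∃ N, ∀ y, pre N y = pre N x → y ∈ U := by
  by_contra! hc
  choose y hy hyU using hc
  have : Tendsto y atTop (𝓝 x) := by
    rw [tendsto_pi_nhds]
    intro i
    apply tendsto_const_nhds.congr'
    filter_upwards [eventually_gt_atTop i] with N hN
    exact ((pre_eq_iff.1 (hy N)) i hN).symm
  obtain ⟨N, hN⟩ := (this.eventually hU).exists
  exact hyU N hN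

/-- `v` acts by the word replacement `w → u`. -/
def Rep (v : Equiv.Perm Cantor) (w u : List Bool) : Prop := ∀ τ, v (capp w τ) = capp u τ

lemma Rep.ext {v w u} (h : Rep v w u) (y : List Bool) : Rep v (w ++ y) (u ++ y) := by
  intro τ
  rw [capp_append, capp_append, h]

lemma Rep.comp {v v' w u t} (h : Rep v w u) (h' : Rep v' u t) : Rep (v' * v) w t := by
  intro τ
  simp [h τ, h' τ]

lemma Rep.inv {v w u} (h : Rep v w u) : Rep v⁻¹ u w := by
  intro τ
  rw [Equiv.Perm.inv_eq_iff_eq, h τ]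

lemma Rep.unique {v w u u'} (h : Rep v w u) (h' : Rep v w u') : u = u' :=
  capp_left_inj (fun τ => by rw [← h τ, h' τ])

/-- `v` scales by `d` at `x`. -/
def Coc (v : Equiv.Perm Cantor) (x : Cantor) (d : ℤ) : Prop :=
  ∃ w u τ, x = capp w τ ∧ Rep v w u ∧ d = (u.length : ℤ) - w.length

lemma InV.coc {v} (h : InV v) (x : Cantor) : ∃ d, Coc v x d := by
  obtain ⟨w, u, h1, h2⟩ := h x
  refine ⟨_, w, u, fun i => x (i + w.length), ?_, h2, rfl⟩
  have : pre w.length x = w := by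
    apply List.ext_getElem
    · simp
    · intro i h3 h4
      simp [pre]; simpa using h1 ⟨i, h4⟩
  conv_lhs => rw [← capp_pre w.length x, this]

lemma Coc.unique {v x d d'} (h : Coc v x d) (h' : Coc v x d') : d = d' := by
  obtain ⟨w, u, τ, rfl, hr, rfl⟩ := h
  obtain ⟨w', u', τ', he, hr', rfl⟩ := h'
  rcases le_total w.length w'.length with hl | hl
  · obtain ⟨y, rfl⟩ := capp_comparable he hl
    rw [hr'.unique (hr.ext y)]; simp
  · obtain ⟨y, rfl⟩ := capp_comparable he.symm hl
    rw [hr.unique (hr'.ext y)]; simp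

lemma Coc.mul {v v' x d d'} (h : Coc v x d) (h' : Coc v' (v x) d') : Coc (v' * v) x (d' + d) := by
  obtain ⟨w, u, τ, rfl, hr, rfl⟩ := h
  obtain ⟨w', u', τ', he, hr', rfl⟩ := h'
  rw [hr] at he
  rcases le_total u.length w'.length with hl | hl
  · obtain ⟨y, rfl⟩ := capp_comparable he hl
    refine ⟨w ++ y, u', τ', ?_, (hr.ext y).comp hr', by simp; ring⟩
    rw [capp_append] at he ⊢
    rw [capp_right_inj he]
  · obtain ⟨y, rfl⟩ := capp_comparable he.symm hl
    exact ⟨w, u' ++ y, τ, rfl, hr.comp (hr'.ext y), by simp; ring⟩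

lemma Coc.inv {v x d} (h : Coc v x d) : Coc v⁻¹ (v x) (-d) := by
  obtain ⟨w, u, τ, rfl, hr, rfl⟩ := h
  exact ⟨u, w, τ, hr τ, hr.inv, by ring⟩

lemma coc_one (x) : Coc 1 x 0 := ⟨[], [], x, by funext i; simp [capp], fun τ => by simp, by simp⟩

/-- Working version of membership in `V`. -/
def HV (v : Equiv.Perm Cantor) : Prop := ∀ x, ∃ d, Coc v x d

lemma HV.mul {v v'} (h : HV v) (h' : HV v') : HV (v * v') := fun x =>
  let ⟨_, hd⟩ := h' x
  let ⟨_, hd'⟩ := h (v' x)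
  ⟨_, hd.mul hd'⟩

lemma HV.inv {v} (h : HV v) : HV v⁻¹ := fun x =>
  let ⟨_, hd⟩ := h (v⁻¹ x)
  ⟨_, by simpa using hd.inv⟩

lemma HV.one : HV 1 := fun x => ⟨0, coc_one x⟩

lemma HV.pow {v} (h : HV v) (k : ℕ) : HV (v ^ k) := by
  induction k with
  | zero => simpa using HV.one
  | succ k ih => rw [pow_succ]; exact ih.mul h

lemma mem_cone_nhds (w : List Bool) (τ : Cantor) : {y | ∃ τ', y = capp w τ'} ∈ 𝓝 (capp w τ) := by
  filter_upwards [pre_mem_nhds w.length (capp w τ)] with y hy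
  rw [pre_capp] at hy
  exact ⟨_, by rw [← hy, capp_pre]⟩

lemma continuous_capp (u : List Bool) : Continuous (capp u) := by
  refine continuous_pi fun i => ?_
  by_cases h : i < u.length
  · simp only [capp_lt _ _ _ h]; fun_prop
  · simp only [capp_ge _ _ _ (not_lt.1 h)]; fun_prop

lemma HV.continuous {v} (h : HV v) : Continuous v := by
  rw [continuous_iff_continuousAt]
  intro x
  obtain ⟨d, w, u, τ, rfl, hr, -⟩ := h x
  have hc : Continuous (fun y : Cantor => capp u (fun i => y (i + w.length))) :=
    (continuous_capp u).comp (by fun_prop)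
  refine hc.continuousAt.congr ?_
  filter_upwards [mem_cone_nhds w τ] with y hy
  obtain ⟨τ', rfl⟩ := hy
  rw [hr]
  congr 1
  funext i
  rw [capp_ge _ _ _ (by omega)]
  simp

/-- the germ of `v` at `p` is trivial -/
def TG (v : Equiv.Perm Cantor) (p : Cantor) : Prop := ∀ᶠ x in 𝓝 p, v x = x

lemma tg_of_coc_zero {v p} (hp : v p = p) (h : Coc v p 0) : TG v p := by
  obtain ⟨w, u, τ, rfl, hr, h0⟩ := h
  have : w = u := by
    rw [hr] at hp
    rw [← pre_capp w τ, ← pre_capp u τ, hp]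
    congr 1; omega
  subst this
  filter_upwards [mem_cone_nhds w τ] with y hy
  obtain ⟨τ', rfl⟩ := hy
  exact hr τ'

lemma fix_unique_aux {w u : List Bool} {τ τ'} (hl : w.length < u.length)
    (h1 : capp w τ = capp u τ) (h2 : capp w τ' = capp u τ') : capp w τ = capp w τ' := by
  funext i
  induction i using Nat.strong_induction_on with
  | _ i ih =>
    by_cases h : i < u.length
    · rw [h1, h2, capp_lt _ _ _ h, capp_lt _ _ _ h]
    · have h3 := ih (i - u.length + w.length) (by omega)
      rw [capp_ge _ _ _ (by omega), capp_ge _ _ _ (by omega)] at h3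
      rw [h1, h2, capp_ge _ _ _ (by omega), capp_ge _ _ _ (by omega)]
      simpa using h3

lemma fix_unique {v w u τ τ'} (hr : Rep v w u) (hl : w.length ≠ u.length)
    (h1 : v (capp w τ) = capp w τ) (h2 : v (capp w τ') = capp w τ') : capp w τ = capp w τ' := by
  rw [hr] at h1 h2
  rcases lt_or_gt_of_ne hl with hl | hl
  · exact fix_unique_aux hl h1.symm h2.symm
  · rw [← h1, ← h2]
    exact fix_unique_aux hl h1 h2

lemma rep_pow {v : Equiv.Perm Cantor} {w b : List Bool} (h : Rep v w (w ++ b)) (k : ℕ) :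
    ∃ y : List Bool, y.length = k * b.length ∧ Rep (v ^ k) w (w ++ y) := by
  induction k with
  | zero => exact ⟨[], by simp, fun τ => by simp⟩
  | succ k ih =>
    obtain ⟨y, hy, hr⟩ := ih
    refine ⟨y ++ b, by simp [hy]; ring, ?_⟩
    rw [pow_succ, ← List.append_assoc]
    exact h.comp (hr.ext b)

lemma exists_uniform {v} (h : HV v) : ∃ D, ∀ x, ∀ E, D ≤ E → ∃ u, Rep v (pre E x) u := by
  have := isCompact_univ (X := Cantor) |>.induction_on
    (p := fun s => ∃ D, ∀ x ∈ s, ∀ E, D ≤ E → ∃ u, Rep v (pre E x) u) ⟨0, by simp⟩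
    (fun s t hst ⟨D, hD⟩ => ⟨D, fun x hx => hD x (hst hx)⟩)
    (fun s t ⟨D, hD⟩ ⟨D', hD'⟩ => ⟨max D D', fun x hx E hE => by
      rcases hx with hx | hx
      · exact hD x hx E (by omega)
      · exact hD' x hx E (by omega)⟩)
    (fun x _ => by
      obtain ⟨d, w, u, τ, rfl, hr, -⟩ := h x
      refine ⟨_, mem_nhdsWithin_of_mem_nhds (mem_cone_nhds w τ), w.length, ?_⟩
      rintro _ ⟨τ', rfl⟩ E hE
      have h1 := capp_pre E (capp w τ')
      obtain ⟨y, hy⟩ := capp_comparable h1.symm (by simpa using hE)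
      rw [hy]
      exact ⟨_, hr.ext y⟩)
  obtain ⟨D, hD⟩ := this
  exact ⟨D, fun x => hD x (mem_univ _)⟩

end FnV

namespace FnV

open Set Filter Topology

lemma pre_mono {D E : ℕ} (h : D ≤ E) {x y : Cantor} (he : pre E x = pre E y) :
    pre D x = pre D y := by
  rw [pre_eq_iff] at he ⊢
  exact fun i hi => he i (by omega)

lemma periodic_word (b : List Bool) (hb : b ≠ []) : ∃ τ : Cantor, capp b τ = τ := by
  have hb' : 0 < b.length := List.length_pos_iff.2 hb
  refine ⟨fun i => b[i % b.length]'(Nat.mod_lt _ hb'), ?_⟩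
  funext i
  by_cases h : i < b.length
  · rw [capp_lt _ _ _ h]
    simp [Nat.mod_eq_of_lt h]
  · rw [capp_ge _ _ _ (by omega)]
    simp only [Nat.mod_eq_sub_mod (not_lt.1 h)]

/-- A cone mapped into itself gives an attracting point. -/
lemma attract {v : Equiv.Perm Cantor} {w b : List Bool} {σ : Cantor} (hr : Rep v w (w ++ b))
    (hx : v (capp w σ) ≠ capp w σ) :
    ∃ p, v p = p ∧ ¬ TG v p ∧ ∀ U ∈ 𝓝 p, ∃ k : ℕ, (v ^ k) (capp w σ) ∈ U := by
  have hb : b ≠ [] := by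
    rintro rfl
    apply hx
    rw [hr]; simp
  obtain ⟨τ, hτ⟩ := periodic_word b hb
  have hp : v (capp w τ) = capp w τ := by rw [hr, capp_append, hτ]
  have hpk : ∀ k : ℕ, (v ^ k) (capp w τ) = capp w τ := by
    intro k
    induction k with
    | zero => simp
    | succ k ih => rw [pow_succ, Equiv.Perm.mul_apply, hp, ih]
  have hacc : ∀ U ∈ 𝓝 (capp w τ), ∃ k : ℕ, (v ^ k) (capp w σ) ∈ U := by
    intro U hU
    obtain ⟨N, hN⟩ := exists_pre_subset hU
    obtain ⟨y, hy, hk⟩ := rep_pow hr N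
    refine ⟨N, hN _ ?_⟩
    have h1 : 0 < b.length := List.length_pos_iff.2 hb
    refine pre_mono (E := (w ++ y).length) ?_ ?_
    · rw [List.length_append, hy]; nlinarith
    · conv_rhs => rw [← hpk N, hk, pre_capp]
      rw [hk, pre_capp]
  refine ⟨_, hp, fun hT => ?_, hacc⟩
  obtain ⟨k, hk⟩ := hacc _ hT
  apply hx
  have h2 : v ((v ^ k) (capp w σ)) = (v ^ k) (capp w σ) := hk
  rw [← Equiv.Perm.mul_apply, ← pow_succ', pow_succ, Equiv.Perm.mul_apply] at h2
  exact (v ^ k).injective h2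

lemma coc_pow_sub {v : Equiv.Perm Cantor} {x : Cantor} {i j : ℕ} {d e : ℤ} (h : Coc (v ^ i) x d)
    (h' : Coc (v ^ j) x e) (hij : i ≤ j) : Coc (v ^ (j - i)) ((v ^ i) x) (e - d) := by
  have h1 := h.inv.mul (v' := v ^ j) (d' := e) (by simpa using h')
  rwa [← sub_eq_add_neg, ← pow_sub _ hij] at h1

lemma rep_forward {v : Equiv.Perm Cantor} {D : ℕ}
    (hD : ∀ x, ∃ u, Rep v (pre D x) u) (x : Cantor) (m : ℕ)
    (h : ∀ i ≤ m, ∃ d, 0 ≤ d ∧ Coc (v ^ i) x d) :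
    ∃ u, Rep (v ^ m) (pre D x) u ∧ D ≤ u.length := by
  have key : ∀ m, (∀ i ≤ m, ∃ d, 0 ≤ d ∧ Coc (v ^ i) x d) → ∀ u, Rep (v ^ m) (pre D x) u →
      D ≤ u.length := by
    intro m h u hu
    obtain ⟨d, hd, hc⟩ := h m le_rfl
    have h2 : Coc (v ^ m) x ((u.length : ℤ) - D) :=
      ⟨pre D x, u, _, (capp_pre D x).symm, hu, by simp⟩
    have := hc.unique h2
    omega
  suffices ∃ u, Rep (v ^ m) (pre D x) u by
    obtain ⟨u, hu⟩ := this
    exact ⟨u, hu, key m h u hu⟩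
  induction m with
  | zero => exact ⟨pre D x, fun τ => by simp⟩
  | succ m ih =>
    obtain ⟨u, hu⟩ := ih (fun i hi => h i (by omega))
    have hl := key m (fun i hi => h i (by omega)) u hu
    obtain ⟨u', hu'⟩ := hD (capp u (fun _ => true))
    obtain ⟨y, hy⟩ := capp_comparable (capp_pre D (capp u (fun _ => true))) (by simpa using hl)
    refine ⟨u' ++ y, ?_⟩
    rw [pow_succ']
    have h3 := hu'.ext y
    rw [← hy] at h3
    exact hu.comp h3

lemma attract_pair {v : Equiv.Perm Cantor} {D : ℕ}
    (hD : ∀ x, ∃ u, Rep v (pre D x) u) (x : Cantor) (m : ℕ)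
    (h : ∀ i ≤ m, ∃ d, 0 ≤ d ∧ Coc (v ^ i) x d) (hne : (v ^ m) x ≠ x)
    (hpre : pre D ((v ^ m) x) = pre D x) :
    ∃ p, (v ^ m) p = p ∧ ¬ TG (v ^ m) p ∧ ∀ U ∈ 𝓝 p, ∃ k : ℕ, ((v ^ m) ^ k) x ∈ U := by
  obtain ⟨u, hu, hl⟩ := rep_forward hD x m h
  have hx := capp_pre D x
  have h1 : (v ^ m) x = capp u (fun i => x (i + D)) := by
    rw [← hu, hx]
  have h2 := capp_pre D ((v ^ m) x)
  rw [hpre] at h2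
  obtain ⟨b, rfl⟩ := capp_comparable (h2.trans h1) (by simpa using hl)
  have := attract (σ := fun i => x (i + D)) hu (by rw [hx]; exact hne)
  rwa [hx] at this

lemma seq_dichotomy (S : ℕ → ℤ) :
    {k | ∀ j, k ≤ j → S k ≤ S j}.Infinite ∨ {k | ∀ j, j ≤ k → S k ≤ S j}.Infinite := by
  by_cases hb : ∃ B, ∀ k, B ≤ S k
  · left
    obtain ⟨B, hB⟩ := hb
    rw [Set.infinite_iff_exists_gt]
    intro N
    -- minimum of S over k > N
    have hw : ∃ n : ℕ, ∃ k, N < k ∧ S k - B = n :=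
      ⟨(S (N + 1) - B).toNat, N + 1, by omega, by have := hB (N + 1); omega⟩
    classical
    obtain ⟨k, hk, hk2⟩ := Nat.find_spec hw
    refine ⟨k, fun j hj => ?_, hk⟩
    have := Nat.find_min' hw (m := (S j - B).toNat) ⟨j, by omega, by have := hB j; omega⟩
    have := hB j
    omega
  · right
    push Not at hb
    rw [Set.infinite_iff_exists_gt]
    intro N
    have hfin : ∃ B, ∀ k ≤ N, B ≤ S k := by
      obtain ⟨B, hB⟩ := ((Set.finite_Iic N).image S).bddBelow
      exact ⟨B, fun k hk => hB ⟨k, hk, rfl⟩⟩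
    obtain ⟨B, hB⟩ := hfin
    have hw := hb B
    classical
    have h1 := Nat.find_spec hw
    refine ⟨Nat.find hw, fun j hj => ?_, ?_⟩
    · rcases hj.eq_or_lt with rfl | hj
      · exact le_rfl
      · have := Nat.find_min hw hj
        omega
    · by_contra hc
      have := hB _ (not_lt.1 hc)
      omega

lemma tg_inv {v p} (h : TG v p) : TG v⁻¹ p := by
  filter_upwards [h] with x hx
  rw [Equiv.Perm.inv_eq_iff_eq, hx]

/-- Infinite orbits accumulate at a hyperbolic periodic point. -/
lemma hyperbolic {v} (h : HV v) (x : Cantor) (hx : ∀ k : ℕ, 1 ≤ k → (v ^ k) x ≠ x) :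
    ∃ m : ℕ, 1 ≤ m ∧ ∃ p, (v ^ m) p = p ∧ ¬ TG (v ^ m) p ∧
      ∀ U ∈ 𝓝 p, ∃ k : ℤ, (v ^ k) x ∈ U := by
  obtain ⟨D₁, hD₁⟩ := exists_uniform h
  obtain ⟨D₂, hD₂⟩ := exists_uniform h.inv
  set D := max D₁ D₂
  have hDf : ∀ x, ∃ u, Rep v (pre D x) u := fun x => hD₁ x D (le_max_left _ _)
  have hDb : ∀ x, ∃ u, Rep v⁻¹ (pre D x) u := fun x => hD₂ x D (le_max_right _ _)
  have hS : ∀ k : ℕ, ∃ d, Coc (v ^ k) x d := fun k => h.pow k x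
  choose S hS using hS
  have hfin : (Set.univ : Set (Fin D → Bool)).Finite := Set.finite_univ
  rcases seq_dichotomy S with hi | hi
  · obtain ⟨a, ha, b, hb, hab, he⟩ := hi.exists_lt_map_eq_of_mapsTo
      (f := fun k => (fun i : Fin D => (v ^ k) x i)) (fun _ _ => Set.mem_univ _) hfin
    have hvm : (v ^ (b - a)) ((v ^ a) x) = (v ^ b) x := by
      rw [← Equiv.Perm.mul_apply, ← pow_add, Nat.sub_add_cancel hab.le]
    obtain ⟨p, hp1, hp2, hp3⟩ := attract_pair hDf ((v ^ a) x) (b - a) (fun i hi => by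
      refine ⟨S (a + i) - S a, by linarith [ha (a + i) (by omega)], ?_⟩
      have := coc_pow_sub (hS a) (hS (a + i)) (by omega)
      rwa [Nat.add_sub_cancel_left] at this) (by
        intro hc
        rw [← Equiv.Perm.mul_apply, ← pow_add, add_comm, pow_add, Equiv.Perm.mul_apply] at hc
        exact hx (b - a) (by omega) ((v ^ a).injective hc)) (by
        rw [hvm]; unfold pre; rw [List.ofFn_inj]; exact he.symm)
    refine ⟨b - a, by omega, p, hp1, hp2, fun U hU => ?_⟩
    obtain ⟨k, hk⟩ := hp3 U hU
    refine ⟨(((b - a) * k + a : ℕ) : ℤ), ?_⟩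
    rw [zpow_natCast, pow_add, pow_mul]
    exact hk
  · obtain ⟨a, ha, b, hb, hab, he⟩ := hi.exists_lt_map_eq_of_mapsTo
      (f := fun k => (fun i : Fin D => (v ^ k) x i)) (fun _ _ => Set.mem_univ _) hfin
    have hinv : ∀ i ≤ b, (v⁻¹ ^ i) ((v ^ b) x) = (v ^ (b - i)) x := by
      intro i hi
      rw [inv_pow, Equiv.Perm.inv_eq_iff_eq, ← Equiv.Perm.mul_apply, ← pow_add,
        Nat.add_sub_cancel' hi]
    have hvm : (v⁻¹ ^ (b - a)) ((v ^ b) x) = (v ^ a) x := by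
      rw [hinv _ (by omega)]; congr 2; omega
    obtain ⟨p, hp1, hp2, hp3⟩ := attract_pair hDb ((v ^ b) x) (b - a) (fun i hi => by
      refine ⟨S (b - i) - S b, by linarith [hb (b - i) (by omega)], ?_⟩
      have := (coc_pow_sub (hS (b - i)) (hS b) (by omega)).inv
      rw [← Equiv.Perm.mul_apply, ← pow_add, neg_sub] at this
      rwa [show b - (b - i) = i by omega, show i + (b - i) = b by omega, ← inv_pow] at this) (by
        intro hc
        rw [inv_pow, Equiv.Perm.inv_eq_iff_eq] at hc
        rw [← Equiv.Perm.mul_apply, ← pow_add, add_comm, pow_add, Equiv.Perm.mul_apply] at hc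
        exact hx (b - a) (by omega) ((v ^ b).injective hc.symm)) (by
        rw [hvm]; unfold pre; rw [List.ofFn_inj]; exact he)
    refine ⟨b - a, by omega, p, ?_, ?_, fun U hU => ?_⟩
    · rw [inv_pow, Equiv.Perm.inv_eq_iff_eq] at hp1
      exact hp1.symm
    · intro hT
      exact hp2 (by rw [inv_pow]; exact tg_inv hT)
    obtain ⟨k, hk⟩ := hp3 U hU
    refine ⟨-(((b - a) * k : ℕ) : ℤ) + b, ?_⟩
    rw [zpow_add, zpow_neg, zpow_natCast, zpow_natCast, pow_mul, ← inv_pow, ← inv_pow]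
    exact hk

lemma pow_fix {v : Equiv.Perm Cantor} {x : Cantor} (h : v x = x) (k : ℕ) : (v ^ k) x = x := by
  induction k with
  | zero => simp
  | succ k ih => rw [pow_succ, Equiv.Perm.mul_apply, h, ih]

/-- Near a point fixed with nontrivial germ there are no other periodic points. -/
lemma isolated_aux {v : Equiv.Perm Cantor} {w b : List Bool} (hr : Rep v w (w ++ b))
    (hb : b ≠ []) {τ τ' : Cantor} (hp : v (capp w τ) = capp w τ)
    {k : ℕ} (hk : 1 ≤ k) (hx : (v ^ k) (capp w τ') = capp w τ') : capp w τ' = capp w τ := by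
  obtain ⟨y, hy, hy2⟩ := rep_pow hr k
  refine fix_unique hy2 ?_ hx (pow_fix hp k)
  have : 0 < b.length := List.length_pos_iff.2 hb
  have : 0 < y.length := by rw [hy]; positivity
  simp; exact List.ne_nil_of_length_pos this

lemma isolated {v p} (h : HV v) (hp : v p = p) (hT : ¬ TG v p) :
    ∃ U ∈ 𝓝 p, ∀ x ∈ U, ∀ k : ℕ, 1 ≤ k → (v ^ k) x = x → x = p := by
  obtain ⟨d, hd⟩ := h p
  have hd0 : d ≠ 0 := by
    rintro rfl
    exact hT (tg_of_coc_zero hp hd)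
  obtain ⟨w, u, τ, rfl, hr, rfl⟩ := hd
  have he := hp
  rw [hr] at he
  rcases le_total w.length u.length with hl | hl
  · obtain ⟨b, rfl⟩ := capp_comparable he.symm hl
    refine ⟨_, mem_cone_nhds w τ, ?_⟩
    rintro _ ⟨τ', rfl⟩ k hk hx
    refine isolated_aux hr ?_ hp hk hx
    rintro rfl
    simp at hd0
  · obtain ⟨b, rfl⟩ := capp_comparable he hl
    rw [← he]
    refine ⟨_, mem_cone_nhds u τ, ?_⟩
    rintro _ ⟨τ', rfl⟩ k hk hx
    refine isolated_aux hr.inv ?_ ?_ hk ?_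
    · rintro rfl
      simp at hd0
    · rw [Equiv.Perm.inv_eq_iff_eq, he, hp]
    · rw [inv_pow, Equiv.Perm.inv_eq_iff_eq, hx]

lemma periodic_uniform {v} (h : HV v) :
    ∃ M : ℕ, 1 ≤ M ∧ ∀ x, (∃ k : ℕ, 1 ≤ k ∧ (v ^ k) x = x) → (v ^ M) x = x := by
  have := isCompact_univ (X := Cantor) |>.induction_on
    (p := fun s => ∃ M : ℕ, 1 ≤ M ∧ ∀ x ∈ s, (∃ k : ℕ, 1 ≤ k ∧ (v ^ k) x = x) → (v ^ M) x = x)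
    ⟨1, le_rfl, by simp⟩
    (fun s t hst ⟨D, hD, hD'⟩ => ⟨D, hD, fun x hx => hD' x (hst hx)⟩)
    (fun s t ⟨D, h1, hD⟩ ⟨D', h1', hD'⟩ => ⟨D * D', Nat.mul_pos h1 h1', fun x hx hk => by
      rcases hx with hx | hx
      · rw [pow_mul]; exact pow_fix (hD x hx hk) _
      · rw [mul_comm, pow_mul]; exact pow_fix (hD' x hx hk) _⟩)
    (fun x _ => by
      by_cases hx : ∃ k : ℕ, 1 ≤ k ∧ (v ^ k) x = x
      · obtain ⟨m, hm, hmx⟩ := hx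
        by_cases hT : TG (v ^ m) x
        · exact ⟨_, mem_nhdsWithin_of_mem_nhds hT, m, hm, fun y hy _ => hy⟩
        · obtain ⟨U, hU, hU2⟩ := isolated (h.pow m) hmx hT
          refine ⟨_, mem_nhdsWithin_of_mem_nhds hU, m, hm, ?_⟩
          rintro y hy ⟨k, hk, hky⟩
          rw [hU2 y hy k hk (by rw [← pow_mul, mul_comm, pow_mul]; exact pow_fix hky _), hmx]
      · push Not at hx
        obtain ⟨m, hm, p, hmp, hT, hacc⟩ := hyperbolic h x hx
        obtain ⟨U, hU, hU2⟩ := isolated (h.pow m) hmp hT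
        obtain ⟨k, hk⟩ := hacc _ (interior_mem_nhds.2 hU)
        have hc : Continuous (v ^ k : Equiv.Perm Cantor) := by
          rcases k with k | k
          · simpa using (h.pow k).continuous
          · rw [zpow_negSucc]; exact (h.pow (k + 1)).inv.continuous
        refine ⟨_, mem_nhdsWithin_of_mem_nhds
          ((isOpen_interior.preimage hc).mem_nhds hk), m, hm, ?_⟩
        rintro y hy ⟨l, hl, hly⟩
        have h1 := hU2 _ (interior_subset hy) l hl (by
          rw [← pow_mul, mul_comm, pow_mul]
          apply pow_fix
          rw [← Equiv.Perm.mul_apply, (((Commute.refl v).pow_left l).zpow_right k).eq,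
            Equiv.Perm.mul_apply, hly])
        rw [← h1, ← Equiv.Perm.mul_apply, (((Commute.refl v).pow_left m).zpow_right k).eq,
            Equiv.Perm.mul_apply] at hmp
        exact (v ^ k).injective hmp)
  obtain ⟨D, hD, hD'⟩ := this
  exact ⟨D, hD, fun x => hD' x (mem_univ _)⟩

/-- Points fixed with nontrivial germ are finite in number. -/
lemma finite_hyp {v} (h : HV v) : {q | v q = q ∧ ¬ TG v q}.Finite := by
  have := isCompact_univ (X := Cantor) |>.induction_on
    (p := fun s => (s ∩ {q | v q = q ∧ ¬ TG v q}).Finite)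
    (by simp)
    (fun s t hst ht => ht.subset (by gcongr))
    (fun s t hs ht => by rw [Set.union_inter_distrib_right]; exact hs.union ht)
    (fun x _ => by
      obtain ⟨d, w, u, τ, rfl, hr, -⟩ := h x
      refine ⟨_, mem_nhdsWithin_of_mem_nhds (mem_cone_nhds w τ), ?_⟩
      apply Set.Subsingleton.finite
      rintro _ ⟨⟨τ', rfl⟩, h1, h2⟩ _ ⟨⟨τ'', rfl⟩, h3, h4⟩
      refine fix_unique hr (fun hl => h2 ?_) h1 h3
      exact tg_of_coc_zero h1 ⟨w, u, τ', rfl, hr, by omega⟩)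
  simpa using this

lemma tg_mul {v v' p} (h : TG v p) (h' : TG v' p) : TG (v * v') p := by
  filter_upwards [h, h'] with x hx hx'
  simp [hx, hx']

lemma tg_commutator {v v' p} (h : HV v) (h' : HV v') (hp : v p = p) (hp' : v' p = p) :
    TG (v * v' * v⁻¹ * v'⁻¹) p := by
  obtain ⟨d, hd⟩ := h p
  obtain ⟨d', hd'⟩ := h' p
  have hi := hd.inv
  have hi' := hd'.inv
  rw [hp] at hi
  rw [hp'] at hi'
  have ei : v⁻¹ p = p := by rw [Equiv.Perm.inv_eq_iff_eq, hp]
  have ei' : v'⁻¹ p = p := by rw [Equiv.Perm.inv_eq_iff_eq, hp']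
  apply tg_of_coc_zero
  · rw [Equiv.Perm.mul_apply, Equiv.Perm.mul_apply, Equiv.Perm.mul_apply, ei', ei, hp', hp]
  · have h1 : Coc (v⁻¹ * v'⁻¹) p (-d + -d') := hi'.mul (by rwa [ei'])
    have h2 : Coc (v' * (v⁻¹ * v'⁻¹)) p (d' + (-d + -d')) := h1.mul (by
      rw [Equiv.Perm.mul_apply, ei', ei]; exact hd')
    have h3 : Coc (v * (v' * (v⁻¹ * v'⁻¹))) p (d + (d' + (-d + -d'))) :=
      h2.mul (by
      rw [Equiv.Perm.mul_apply, Equiv.Perm.mul_apply, ei', ei, hp']; exact hd)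
    rw [show v * v' * v⁻¹ * v'⁻¹ = v * (v' * (v⁻¹ * v'⁻¹)) by group]
    convert h3 using 1
    ring

end FnV

namespace FnV

open Set Filter Topology

open scoped commutatorElement

variable {Γ : Type*} [Group Γ]

/-- Elements supported in a compact subset of `(α, β)`. -/
def Gs (a : Γ →* Equiv.Perm ℝ) (α β : ℝ) : Subgroup Γ where
  carrier := {g | ∃ c d, α < c ∧ d < β ∧ ∀ x, x ∉ Icc c d → a g x = x}
  one_mem' := ⟨α + 1, β - 1, by simp, by simp, fun x _ => by simp⟩
  mul_mem' := by
    rintro g h ⟨c, d, hc, hd, hg⟩ ⟨c', d', hc', hd', hh⟩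
    refine ⟨min c c', max d d', lt_min hc hc', max_lt hd hd', fun x hx => ?_⟩
    rw [map_mul, Equiv.Perm.mul_apply, hh, hg]
    · exact fun h => hx ⟨(min_le_left _ _).trans h.1, h.2.trans (le_max_left _ _)⟩
    · exact fun h => hx ⟨(min_le_right _ _).trans h.1, h.2.trans (le_max_right _ _)⟩
  inv_mem' := by
    rintro g ⟨c, d, hc, hd, hg⟩
    refine ⟨c, d, hc, hd, fun x hx => ?_⟩
    rw [map_inv, Equiv.Perm.inv_eq_iff_eq, hg x hx]

/-- The properties of the action on the line that are used. -/
structure Loc (a : Γ →* Equiv.Perm ℝ) : Prop where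
  inj : Function.Injective a
  mono : ∀ g, Monotone (a g)
  out : ∀ g x, x ∉ Ioo (0 : ℝ) 1 → a g x = x
  loc : ∀ α p β, 0 ≤ α → α < p → p < β → β ≤ 1 → ∃ g ∈ Gs a α β, a g p ≠ p

/-- Commutator subgroup of the local group. -/
def Cs (a : Γ →* Equiv.Perm ℝ) (α β : ℝ) : Subgroup Γ := ⁅Gs a α β, Gs a α β⁆

variable {a : Γ →* Equiv.Perm ℝ}

lemma Loc.smono (L : Loc a) (g : Γ) : StrictMono (a g) :=
  (L.mono g).strictMono_of_injective (a g).injective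

lemma inv_apply (a : Γ →* Equiv.Perm ℝ) (g : Γ) (x : ℝ) : a g⁻¹ (a g x) = x := by simp

lemma apply_inv (a : Γ →* Equiv.Perm ℝ) (g : Γ) (x : ℝ) : a g (a g⁻¹ x) = x := by simp

lemma mul_app (a : Γ →* Equiv.Perm ℝ) (g h : Γ) (x : ℝ) : a (g * h) x = a g (a h x) := by simp

lemma inv_ne {g : Γ} {x : ℝ} (h : a g x ≠ x) : a g⁻¹ x ≠ x := by
  intro h'
  apply h
  conv_lhs => rw [← h']
  exact apply_inv a g x

lemma Loc.inv_lt (L : Loc a) {g : Γ} {x : ℝ} (h : a g x < x) : x < a g⁻¹ x := by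
  have := L.smono g⁻¹ h
  rwa [inv_apply] at this

lemma Loc.lt_inv (L : Loc a) {g : Γ} {x : ℝ} (h : x < a g x) : a g⁻¹ x < x := by
  have := L.smono g⁻¹ h
  rwa [inv_apply] at this

lemma gs_fix_le {g : Γ} {α β x : ℝ} (h : g ∈ Gs a α β) (hx : x ≤ α) : a g x = x := by
  obtain ⟨c, d, hc, hd, hg⟩ := h
  exact hg x (fun h => by linarith [h.1])

lemma gs_fix_ge {g : Γ} {α β x : ℝ} (h : g ∈ Gs a α β) (hx : β ≤ x) : a g x = x := by
  obtain ⟨c, d, hc, hd, hg⟩ := h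
  exact hg x (fun h => by linarith [h.2])

lemma Loc.gs_gt (L : Loc a) {g : Γ} {α β x : ℝ} (h : g ∈ Gs a α β) (hx : α < x) : α < a g x := by
  have := L.smono g hx
  rwa [gs_fix_le h le_rfl] at this

lemma Loc.gs_lt (L : Loc a) {g : Γ} {α β x : ℝ} (h : g ∈ Gs a α β) (hx : x < β) : a g x < β := by
  have := L.smono g hx
  rwa [gs_fix_ge h le_rfl] at this

lemma gs_mono {α α' β β' : ℝ} (h : α' ≤ α) (h' : β ≤ β') : Gs a α β ≤ Gs a α' β' := by
  rintro g ⟨c, d, hc, hd, hg⟩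
  exact ⟨c, d, by linarith, by linarith, hg⟩

lemma cs_mono {α α' β β' : ℝ} (h : α' ≤ α) (h' : β ≤ β') : Cs a α β ≤ Cs a α' β' :=
  Subgroup.commutator_mono (gs_mono h h') (gs_mono h h')

lemma cs_le_gs (α β : ℝ) : Cs a α β ≤ Gs a α β := by
  unfold Cs
  rw [Subgroup.commutator_le]
  intro g hg h hh
  rw [commutatorElement_def]
  exact mul_mem (mul_mem (mul_mem hg hh) (inv_mem hg)) (inv_mem hh)

lemma Loc.gs_conj (L : Loc a) (f : Γ) {g : Γ} {α β : ℝ} (h : g ∈ Gs a α β) :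
    f * g * f⁻¹ ∈ Gs a (a f α) (a f β) := by
  obtain ⟨c, d, hc, hd, hg⟩ := h
  refine ⟨a f c, a f d, L.smono f hc, L.smono f hd, fun x hx => ?_⟩
  rw [mul_app, mul_app, hg, apply_inv]
  intro h
  apply hx
  rw [← apply_inv a f x]
  exact ⟨L.mono f h.1, L.mono f h.2⟩

lemma commutator_conj {H K : Subgroup Γ} (f : Γ) (h : ∀ g ∈ H, f * g * f⁻¹ ∈ K) :
    ∀ g ∈ ⁅H, H⁆, f * g * f⁻¹ ∈ ⁅K, K⁆ := by
  have : ⁅H, H⁆ ≤ (⁅K, K⁆).comap (MulAut.conj f).toMonoidHom := by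
    rw [Subgroup.commutator_le]
    intro g hg g' hg'
    simp only [Subgroup.mem_comap, MulEquiv.coe_toMonoidHom, MulAut.conj_apply]
    rw [conjugate_commutatorElement]
    exact Subgroup.commutator_mem_commutator (h g hg) (h g' hg')
  exact this

lemma Loc.cs_conj (L : Loc a) (f : Γ) {g : Γ} {α β : ℝ} (h : g ∈ Cs a α β) :
    f * g * f⁻¹ ∈ Cs a (a f α) (a f β) :=
  commutator_conj f (fun _ hg => L.gs_conj f hg) g h

/-- A point moved up has a neighbourhood moved off itself. -/
lemma Loc.displace (L : Loc a) {f : Γ} {p α β : ℝ} (hα : α < p) (hβ : p < β) (hf : p < a f p) :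
    ∃ u v, α ≤ u ∧ u < p ∧ p < v ∧ v ≤ β ∧ v ≤ a f u := by
  obtain ⟨m, hm, hm'⟩ := exists_between hf
  have h1 : a f⁻¹ m < p := by
    have := L.smono f⁻¹ hm'
    rwa [inv_apply] at this
  refine ⟨max α (a f⁻¹ m), min β m, le_max_left _ _, max_lt hα h1, lt_min hβ hm, min_le_left _ _,
    (min_le_right _ _).trans ?_⟩
  have := L.mono f (le_max_right α (a f⁻¹ m))
  rwa [apply_inv] at this

lemma Loc.moving_commutator (L : Loc a) (H : ℝ → ℝ → Subgroup Γ) (hH : ∀ α β, H α β ≤ Gs a α β)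
    (hm : ∀ α α' β β', α' ≤ α → β ≤ β' → H α β ≤ H α' β')
    (hl : ∀ α p β, 0 ≤ α → α < p → p < β → β ≤ 1 → ∃ g ∈ H α β, a g p ≠ p)
    (α p β : ℝ) (h0 : 0 ≤ α) (h1 : α < p) (h2 : p < β) (h3 : β ≤ 1) :
    ∃ g ∈ ⁅H α β, H α β⁆, a g p ≠ p := by
  have : ∃ f ∈ H α β, p < a f p := by
    obtain ⟨f, hf, hp⟩ := hl α p β h0 h1 h2 h3
    rcases lt_or_gt_of_ne hp with h | h
    · exact ⟨f⁻¹, inv_mem hf, L.inv_lt h⟩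
    · exact ⟨f, hf, h⟩
  obtain ⟨f, hf, hfp⟩ := this
  obtain ⟨u, v, hu, hup, hvp, hv, huv⟩ := L.displace h1 h2 hfp
  obtain ⟨h, hh, hhp⟩ := hl u p v (by linarith) hup hvp (by linarith)
  refine ⟨⁅f, h⁆, Subgroup.commutator_mem_commutator hf (hm _ _ _ _ hu hv hh), ?_⟩
  have hh' := hH _ _ (inv_mem hh)
  have hq := L.gs_lt hh' hvp
  have : a f⁻¹ (a h⁻¹ p) ≤ u := by
    have := L.mono f⁻¹ (hq.le.trans huv)
    rwa [inv_apply] at this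
  rw [commutatorElement_def, mul_app, mul_app, mul_app, gs_fix_le (hH _ _ hh) this, apply_inv]
  exact inv_ne hhp

lemma Loc.cs_moving (L : Loc a) (α p β : ℝ) (h0 : 0 ≤ α) (h1 : α < p) (h2 : p < β) (h3 : β ≤ 1) :
    ∃ g ∈ Cs a α β, a g p ≠ p :=
  L.moving_commutator (Gs a) (fun _ _ => le_rfl) (fun _ _ _ _ => gs_mono) L.loc α p β h0 h1 h2 h3

lemma Loc.css_moving (L : Loc a) (α p β : ℝ) (h0 : 0 ≤ α) (h1 : α < p) (h2 : p < β) (h3 : β ≤ 1) :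
    ∃ g ∈ ⁅Cs a α β, Cs a α β⁆, a g p ≠ p :=
  L.moving_commutator (Cs a) cs_le_gs (fun _ _ _ _ => cs_mono) L.cs_moving α p β h0 h1 h2 h3

lemma Loc.push_up (L : Loc a) {α β c u : ℝ} (h0 : 0 ≤ α) (h1 : β ≤ 1) (hc : α < c)
    (hu : u < β) : ∃ k ∈ Gs a α β, u < a k c := by
  by_contra! hcon
  set S := {y | ∃ k ∈ Gs a α β, y = a k c}
  have hne : S.Nonempty := ⟨c, 1, one_mem _, by simp⟩
  have hbd : BddAbove S := ⟨u, by rintro _ ⟨k, hk, rfl⟩; exact hcon k hk⟩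
  have hm1 : sSup S ≤ u := csSup_le hne (by rintro _ ⟨k, hk, rfl⟩; exact hcon k hk)
  have hm2 : c ≤ sSup S := le_csSup hbd ⟨1, one_mem _, by simp⟩
  have : ∃ f ∈ Gs a α β, sSup S < a f (sSup S) := by
    obtain ⟨f, hf, hp⟩ := L.loc α (sSup S) β h0 (by linarith) (by linarith) h1
    rcases lt_or_gt_of_ne hp with h | h
    · exact ⟨f⁻¹, inv_mem hf, L.inv_lt h⟩
    · exact ⟨f, hf, h⟩
  obtain ⟨f, hf, hlt⟩ := this
  obtain ⟨_, ⟨k, hk, rfl⟩, hk2⟩ := exists_lt_of_lt_csSup hne (L.lt_inv hlt)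
  have h4 := L.smono f hk2
  rw [apply_inv, ← mul_app] at h4
  exact absurd (le_csSup hbd ⟨f * k, mul_mem hf hk, rfl⟩) (not_le.2 h4)

lemma Loc.push_down (L : Loc a) {α β d v : ℝ} (h0 : 0 ≤ α) (h1 : β ≤ 1) (hd : d < β)
    (hv : α < v) : ∃ k ∈ Gs a α β, a k d < v := by
  obtain ⟨k, hk, hk2⟩ := L.push_up h0 h1 hv hd
  refine ⟨k⁻¹, inv_mem hk, ?_⟩
  have := L.smono k⁻¹ hk2
  rwa [inv_apply] at this

lemma Loc.compress (L : Loc a) {α β c d u v : ℝ} (h0 : 0 ≤ α) (h1 : β ≤ 1) (hc : α < c)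
    (hcd : c ≤ d) (hd : d < β) (hu : α ≤ u) (huv : u < v) (hv : v ≤ β) :
    ∃ k ∈ Gs a α β, u < a k c ∧ a k d < v := by
  obtain ⟨k, hk, hk2⟩ := L.push_up h0 h1 hc (huv.trans_le hv)
  obtain ⟨l, hl, hl2⟩ := L.push_down (α := u) (by linarith) h1 (L.gs_lt hk hd) huv
  refine ⟨l * k, mul_mem (gs_mono hu le_rfl hl) hk, ?_, by rwa [mul_app]⟩
  rw [mul_app]
  exact L.gs_gt hl hk2

lemma Loc.ext (L : Loc a) {g h : Γ} (e : ∀ x, a g x = a h x) : g = h :=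
  L.inj (Equiv.ext e)

lemma Loc.commute (L : Loc a) {g h : Γ} {α β β' γ : ℝ} (hg : g ∈ Gs a α β) (hh : h ∈ Gs a β' γ)
    (hb : β ≤ β') : g * h = h * g := by
  apply L.ext
  intro z
  rw [mul_app, mul_app]
  rcases le_or_gt z β with hz | hz
  · rw [gs_fix_le hh (hz.trans hb), gs_fix_le hh]
    have := L.mono g hz
    rw [gs_fix_ge hg le_rfl] at this
    exact this.trans hb
  · rw [gs_fix_ge hg hz.le, gs_fix_ge hg]
    have := L.smono h hz
    rw [gs_fix_le hh hb] at this
    exact this.le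

lemma Loc.normal (L : Loc a) {α β : ℝ} (h0 : 0 ≤ α) (h1 : β ≤ 1) (N : Subgroup Γ)
    (hN : ∀ g ∈ Gs a α β, ∀ n ∈ N, g * n * g⁻¹ ∈ N) {f₀ : Γ} (hf₀ : f₀ ∈ Gs a α β) (hfN₀ : f₀ ∈ N)
    (hne : f₀ ≠ 1) : Cs a α β ≤ N := by
  have : ∃ f ∈ Gs a α β, f ∈ N ∧ ∃ p, p < a f p := by
    have : ∃ p, a f₀ p ≠ p := by
      by_contra! hc
      exact hne (L.ext fun x => by rw [hc]; simp)
    obtain ⟨p, hp⟩ := this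
    rcases lt_or_gt_of_ne hp with h | h
    · exact ⟨f₀⁻¹, inv_mem hf₀, inv_mem hfN₀, p, L.inv_lt h⟩
    · exact ⟨f₀, hf₀, hfN₀, p, h⟩
  obtain ⟨f, hf, hfN, p, hp⟩ := this
  have hpα : α < p := by
    by_contra! hc
    rw [gs_fix_le hf hc] at hp
    exact lt_irrefl _ hp
  have hpβ : p < β := by
    by_contra! hc
    rw [gs_fix_ge hf hc] at hp
    exact lt_irrefl _ hp
  obtain ⟨u, v, hu, hup, hvp, hv, huv⟩ := L.displace hpα hpβ hp
  unfold Cs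
  rw [Subgroup.commutator_le]
  intro g hg h hh
  obtain ⟨c, d, hc, hd, hgs⟩ := hg
  obtain ⟨c', d', hc', hd', hhs⟩ := hh
  obtain ⟨k, hk, hk1, hk2⟩ := L.compress (c := min (min c c') p) (d := max (max d d') p) h0 h1
    (lt_min (lt_min hc hc') hpα) ((min_le_right _ _).trans (le_max_right _ _))
    (max_lt (max_lt hd hd') hpβ) hu (hup.trans hvp) hv
  have key : ∀ g c d, (∀ x, x ∉ Icc c d → a g x = x) → u < a k c → a k d < v →
      k * g * k⁻¹ ∈ Gs a u v := by
    intro g c d hg hc hd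
    refine ⟨a k c, a k d, hc, hd, fun x hx => ?_⟩
    rw [mul_app, mul_app, hg, apply_inv]
    intro h
    apply hx
    rw [← apply_inv a k x]
    exact ⟨L.mono k h.1, L.mono k h.2⟩
  have hg' : k * g * k⁻¹ ∈ Gs a u v := key g c d hgs
    (hk1.trans_le (L.mono k ((min_le_left _ _).trans (min_le_left _ _))))
    ((L.mono k ((le_max_left _ _).trans (le_max_left _ _))).trans_lt hk2)
  have hh' : k * h * k⁻¹ ∈ Gs a u v := key h c' d' hhs
    (hk1.trans_le (L.mono k ((min_le_left _ _).trans (min_le_right _ _))))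
    ((L.mono k ((le_max_right _ _).trans (le_max_left _ _))).trans_lt hk2)
  set g' := k * g * k⁻¹ with hgdef
  set h' := k * h * k⁻¹ with hhdef
  have hgG : g' ∈ Gs a α β := gs_mono hu hv hg'
  have hhG : h' ∈ Gs a α β := gs_mono hu hv hh'
  have ht : f * g'⁻¹ * f⁻¹ ∈ Gs a (a f u) (a f v) := L.gs_conj f (inv_mem hg')
  have hcomm := L.commute hh' ht huv
  have hn1 : g' * f * g'⁻¹ * f⁻¹ ∈ N := mul_mem (hN g' hgG f hfN) (inv_mem hfN)
  have hn2 : (g' * f * g'⁻¹ * f⁻¹) * (h' * (g' * f * g'⁻¹ * f⁻¹)⁻¹ * h'⁻¹) ∈ N :=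
    mul_mem hn1 (hN h' hhG _ (inv_mem hn1))
  have e1 : (g' * f * g'⁻¹ * f⁻¹) * (h' * (g' * f * g'⁻¹ * f⁻¹)⁻¹ * h'⁻¹) = ⁅g', h'⁆ := by
    set t := f * g'⁻¹ * f⁻¹
    have : g' * f * g'⁻¹ * f⁻¹ = g' * t := by simp only [t]; group
    rw [this, commutatorElement_def]
    calc g' * t * (h' * (g' * t)⁻¹ * h'⁻¹) = g' * (t * h') * t⁻¹ * g'⁻¹ * h'⁻¹ := by group
      _ = g' * h' * g'⁻¹ * h'⁻¹ := by rw [← hcomm]; group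
  rw [e1] at hn2
  have e2 : ⁅g, h⁆ = k⁻¹ * ⁅g', h'⁆ * k⁻¹⁻¹ := by
    rw [conjugate_commutatorElement, hgdef, hhdef]
    congr 1 <;> group
  rw [e2]
  exact hN _ (inv_mem hk) _ hn2

lemma Loc.gs_conj_self (L : Loc a) {α β : ℝ} {f g : Γ} (hf : f ∈ Gs a α β) (hg : g ∈ Gs a α β) :
    f * g * f⁻¹ ∈ Gs a α β := mul_mem (mul_mem hf hg) (inv_mem hf)

lemma Loc.perfect (L : Loc a) {α β : ℝ} (h0 : 0 ≤ α) (h : α < β) (h1 : β ≤ 1) :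
    Cs a α β ≤ ⁅Cs a α β, Cs a α β⁆ := by
  obtain ⟨p, hp, hp'⟩ := exists_between h
  obtain ⟨g, hg, hgp⟩ := L.css_moving α p β h0 hp hp' h1
  refine L.normal h0 h1 _ ?_ (f₀ := g) ?_ hg ?_
  · intro f hf
    exact commutator_conj f (commutator_conj f (fun g hg => mul_mem (mul_mem hf hg) (inv_mem hf)))
  · apply cs_le_gs
    have : ⁅Cs a α β, Cs a α β⁆ ≤ Cs a α β := by
      conv_rhs => unfold Cs
      exact Subgroup.commutator_mono (cs_le_gs _ _) (cs_le_gs _ _)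
    exact this hg
  · rintro rfl
    simp at hgp

lemma Loc.pow_ne_one (L : Loc a) {g : Γ} (hg : g ≠ 1) {k : ℕ} (hk : 1 ≤ k) : g ^ k ≠ 1 := by
  have key : ∀ g : Γ, ∀ p, p < a g p → g ^ k ≠ 1 := by
    intro g p hp h1
    have : ∀ j : ℕ, p < a (g ^ (j + 1)) p := by
      intro j
      induction j with
      | zero => simpa using hp
      | succ j ih =>
        rw [pow_succ', mul_app]
        exact hp.trans (L.smono g ih)
    have h2 := this (k - 1)
    rw [Nat.sub_add_cancel hk, h1] at h2
    simp at h2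
  have : ∃ p, a g p ≠ p := by
    by_contra! hc
    exact hg (L.ext fun x => by rw [hc]; simp)
  obtain ⟨p, hp⟩ := this
  rcases lt_or_gt_of_ne hp with h | h
  · intro h1
    exact key g⁻¹ p (L.inv_lt h) (by rw [inv_pow, h1, inv_one])
  · exact key g p h

end FnV

namespace FnV

open Set Filter Topology

open scoped commutatorElement

variable {Γ : Type*} [Group Γ] {a : Γ →* Equiv.Perm ℝ} {ι : Γ →* Equiv.Perm Cantor}

/-- `κ` is fixed by the subgroup `H`. -/
def Fx (ι : Γ →* Equiv.Perm Cantor) (H : Subgroup Γ) (κ : Cantor) : Prop := ∀ g ∈ H, ι g κ = κ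

/-- stabilizer -/
def Stab (ι : Γ →* Equiv.Perm Cantor) (κ : Cantor) : Subgroup Γ where
  carrier := {g | ι g κ = κ}
  one_mem' := by simp
  mul_mem' := by
    intro g h hg hh
    simp only [Set.mem_setOf_eq] at *
    rw [map_mul, Equiv.Perm.mul_apply, hh, hg]
  inv_mem' := by
    intro g hg
    simp only [Set.mem_setOf_eq] at *
    rw [map_inv, Equiv.Perm.inv_eq_iff_eq, hg]

/-- pointwise stabilizer of a set -/
def PStab (ι : Γ →* Equiv.Perm Cantor) (P : Set Cantor) : Subgroup Γ := ⨅ q ∈ P, Stab ι q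

lemma mem_pstab {P : Set Cantor} {g : Γ} : g ∈ PStab ι P ↔ ∀ q ∈ P, ι g q = q := by
  simp [PStab, Subgroup.mem_iInf, Stab]

lemma pstab_conj {P : Set Cantor} {H : Subgroup Γ} (hP : ∀ g ∈ H, ∀ q ∈ P, ι g q ∈ P) :
    ∀ g ∈ H, ∀ n ∈ PStab ι P, g * n * g⁻¹ ∈ PStab ι P := by
  intro g hg n hn
  rw [mem_pstab] at hn ⊢
  intro q hq
  rw [map_mul, map_mul, Equiv.Perm.mul_apply, Equiv.Perm.mul_apply, hn _ (hP _ (inv_mem hg) q hq),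
    ← Equiv.Perm.mul_apply, ← map_mul]
  simp

/-- elements with trivial germ -/
def GStab (ι : Γ →* Equiv.Perm Cantor) (p : Cantor) : Subgroup Γ where
  carrier := {g | TG (ι g) p}
  one_mem' := by simp [TG]
  mul_mem' := by
    intro g h hg hh
    simp only [Set.mem_setOf_eq] at *
    rw [map_mul]; exact tg_mul hg hh
  inv_mem' := by
    intro g hg
    simp only [Set.mem_setOf_eq] at *
    rw [map_inv]; exact tg_inv hg

lemma Loc.germ_trivial (L : Loc a) (hV : ∀ g, HV (ι g)) {α β : ℝ} (h0 : 0 ≤ α) (h : α < β)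
    (h1 : β ≤ 1) {p : Cantor} (hp : Fx ι (Cs a α β) p) : ∀ g ∈ Cs a α β, TG (ι g) p := by
  have : ⁅Cs a α β, Cs a α β⁆ ≤ GStab ι p := by
    rw [Subgroup.commutator_le]
    intro g hg h hh
    have := tg_commutator (hV g) (hV h) (hp g hg) (hp h hh)
    rw [← map_inv, ← map_inv, ← map_mul, ← map_mul, ← map_mul] at this
    exact this
  exact fun g hg => this (L.perfect h0 h h1 hg)

lemma Loc.finite_orbits (L : Loc a) (hV : ∀ g, HV (ι g)) {α β : ℝ} (h0 : 0 ≤ α) (h : α < β)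
    (h1 : β ≤ 1) {κ : Cantor} (hf : ∀ f ∈ Gs a α β, ∃ k : ℕ, 1 ≤ k ∧ (ι f ^ k) κ = κ) :
    Fx ι (Cs a α β) κ := by
  set P : Set Cantor := {q | ∃ g ∈ Gs a α β, q = ι g κ}
  obtain ⟨p, hp, hp'⟩ := exists_between h
  obtain ⟨f, hfG, hfp⟩ := L.loc α p β h0 hp hp' h1
  have hf1 : f ≠ 1 := by rintro rfl; simp at hfp
  obtain ⟨M, hM, hM2⟩ := periodic_uniform (hV f)
  have := L.normal h0 h1 (PStab ι P) (pstab_conj ?_) (f₀ := f ^ M) (pow_mem hfG M) ?_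
    (L.pow_ne_one hf1 hM)
  · intro g hg
    exact mem_pstab.1 (this hg) κ ⟨1, one_mem _, by simp⟩
  · rintro g hg _ ⟨g', hg', rfl⟩
    exact ⟨g * g', mul_mem hg hg', by simp⟩
  · rw [mem_pstab]
    rintro _ ⟨g, hg, rfl⟩
    rw [map_pow]
    apply hM2
    obtain ⟨k, hk, hk2⟩ := hf (g⁻¹ * f * g) (mul_mem (mul_mem (inv_mem hg) hfG) hg)
    refine ⟨k, hk, ?_⟩
    rw [← map_pow] at hk2 ⊢
    have e : (g⁻¹ * f * g) ^ k = g⁻¹ * f ^ k * g := by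
      have := conj_pow (i := k) (a := g⁻¹) (b := f)
      simpa using this
    rw [e, map_mul, map_mul, Equiv.Perm.mul_apply, Equiv.Perm.mul_apply, map_inv,
      Equiv.Perm.inv_eq_iff_eq] at hk2
    exact hk2

lemma Loc.infinite_orbit (L : Loc a) (hV : ∀ g, HV (ι g)) {β β' : ℝ} (h0 : 0 ≤ β) (h : β < β')
    (h1 : β' ≤ 1) {κ : Cantor} {f : Γ} (hcomm : ∀ g ∈ Gs a β β', f * g = g * f)
    (hf : ∀ k : ℕ, 1 ≤ k → (ι f ^ k) κ ≠ κ) :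
    Fx ι (Cs a β β') κ := by
  obtain ⟨m, hm, p, hmp, hT, hacc⟩ := hyperbolic (hV f) κ hf
  set P : Set Cantor := {q | (ι f ^ m) q = q ∧ ¬ TG (ι f ^ m) q} with hPdef
  have hPfin : P.Finite := finite_hyp ((hV f).pow m)
  have hcomm' : ∀ g ∈ Gs a β β', Commute (ι f ^ m) (ι g) := fun g hg =>
    Commute.pow_left ((show Commute f g from hcomm g hg).map ι) m
  have hinv : ∀ g ∈ Gs a β β', ∀ q ∈ P, ι g q ∈ P := by
    rintro g hg q ⟨hq1, hq2⟩
    refine ⟨?_, fun ht => hq2 ?_⟩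
    · rw [← Equiv.Perm.mul_apply, (hcomm' g hg).eq, Equiv.Perm.mul_apply, hq1]
    · have := ((hV g).continuous.continuousAt (x := q)).eventually ht
      filter_upwards [this] with x hx
      rw [← Equiv.Perm.mul_apply, (hcomm' g hg).eq, Equiv.Perm.mul_apply] at hx
      exact (ι g).injective hx
  obtain ⟨z, hz, hz'⟩ := exists_between h
  obtain ⟨g, hgG, hgz⟩ := L.loc β z β' h0 hz hz' h1
  have hg1 : g ≠ 1 := by rintro rfl; simp at hgz
  have hgP : ∀ q, ι g q ∈ P ↔ q ∈ P := by
    intro q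
    refine ⟨fun hq => ?_, hinv g hgG q⟩
    have := hinv g⁻¹ (inv_mem hgG) _ hq
    simpa using this
  have hpow : ∃ k : ℕ, 1 ≤ k ∧ g ^ k ∈ PStab ι P := by
    haveI : Finite P := hPfin
    set σ : Equiv.Perm P := (ι g).subtypePerm hgP with hσ
    have hfo : IsOfFinOrder σ := isOfFinOrder_of_finite σ
    refine ⟨orderOf σ, hfo.orderOf_pos, ?_⟩
    rw [mem_pstab]
    intro q hq
    have h2 := pow_orderOf_eq_one σ
    generalize orderOf σ = k at h2
    rw [hσ, Equiv.Perm.subtypePerm_pow] at h2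
    have h3 := congrArg Subtype.val (Equiv.congr_fun h2 ⟨q, hq⟩)
    rw [map_pow]
    simpa using h3
  obtain ⟨k, hk, hkP⟩ := hpow
  have hC := L.normal h0 h1 (PStab ι P) (pstab_conj hinv) (pow_mem hgG k) hkP (L.pow_ne_one hg1 hk)
  have hp : Fx ι (Cs a β β') p := fun c hc => mem_pstab.1 (hC hc) p ⟨hmp, hT⟩
  intro c hc
  have hTG := L.germ_trivial hV h0 h h1 hp c hc
  obtain ⟨j, hj⟩ := hacc _ hTG
  have h4 : ι c ((ι f ^ j) κ) = (ι f ^ j) κ := hj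
  have h5 : Commute (ι c) (ι f ^ j) :=
    ((show Commute f c from hcomm c (cs_le_gs _ _ hc)).map ι).symm.zpow_right j
  rw [← Equiv.Perm.mul_apply, h5.eq, Equiv.Perm.mul_apply] at h4
  exact (ι f ^ j).injective h4

lemma Loc.dichotomy (L : Loc a) (hV : ∀ g, HV (ι g)) {x : ℝ} (h0 : 0 < x) (h1 : x < 1)
    (κ : Cantor) : Fx ι (Cs a 0 x) κ ∨ Fx ι (Cs a x 1) κ := by
  by_cases h : ∀ f ∈ Gs a 0 x, ∃ k : ℕ, 1 ≤ k ∧ (ι f ^ k) κ = κ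
  · exact Or.inl (L.finite_orbits hV le_rfl h0 h1.le h)
  · push Not at h
    obtain ⟨f, hf, hk⟩ := h
    exact Or.inr (L.infinite_orbit hV h0.le h1 le_rfl (fun g hg => L.commute hf hg le_rfl) hk)

lemma Fx.mono {H K : Subgroup Γ} {κ} (h : Fx ι K κ) (hHK : H ≤ K) : Fx ι H κ :=
  fun g hg => h g (hHK hg)

lemma fx_limit {α β : ℝ} {κ : Cantor}
    (h : ∀ α' β', α < α' → β' < β → Fx ι (Cs a α' β') κ) : Fx ι (Cs a α β) κ := by
  have : Cs a α β ≤ Stab ι κ := by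
    conv_lhs => unfold Cs
    rw [Subgroup.commutator_le]
    rintro g ⟨c, d, hc, hd, hg⟩ g' ⟨c', d', hc', hd', hg'⟩
    obtain ⟨α', h1, h2⟩ := exists_between (lt_min hc hc')
    obtain ⟨β', h3, h4⟩ := exists_between (max_lt hd hd')
    refine h α' β' h1 h4 _ (Subgroup.commutator_mem_commutator ?_ ?_)
    · exact ⟨c, d, h2.trans_le (min_le_left _ _), (le_max_left _ _).trans_lt h3, hg⟩
    · exact ⟨c', d', h2.trans_le (min_le_right _ _), (le_max_right _ _).trans_lt h3, hg'⟩
  exact this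

lemma Loc.fx_conj (L : Loc a) {α β : ℝ} {κ : Cantor} (h : Fx ι (Cs a α β) κ) (f : Γ) :
    Fx ι (Cs a (a f α) (a f β)) (ι f κ) := by
  intro g hg
  have := L.cs_conj f⁻¹ hg
  rw [inv_apply, inv_apply] at this
  have h2 := h _ this
  rw [inv_inv, map_mul, map_mul, Equiv.Perm.mul_apply, Equiv.Perm.mul_apply, map_inv,
    Equiv.Perm.inv_eq_iff_eq] at h2
  exact h2

lemma Loc.exists_pt (L : Loc a) (hV : ∀ g, HV (ι g)) {κ : Cantor} (h : ¬ Fx ι (Cs a 0 1) κ) :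
    ∃ y : Ioo (0 : ℝ) 1, Fx ι (Cs a 0 y) κ ∧ Fx ι (Cs a y 1) κ := by
  set S := {x : ℝ | x ∈ Icc (0 : ℝ) 1 ∧ Fx ι (Cs a 0 x) κ}
  have hS0 : (0 : ℝ) ∈ S := by
    refine ⟨by simp, fun g hg => ?_⟩
    have hg' := cs_le_gs _ _ hg
    have : g = 1 := L.ext fun x => by
      rcases le_total x 0 with hx | hx
      · rw [gs_fix_le hg' hx]; simp
      · rw [gs_fix_ge hg' hx]; simp
    simp [this]
  have hbd : BddAbove S := ⟨1, fun x hx => hx.1.2⟩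
  set s := sSup S
  have hs0 : 0 ≤ s := le_csSup hbd hS0
  have hs1 : s ≤ 1 := csSup_le ⟨0, hS0⟩ fun x hx => hx.1.2
  have hsS : Fx ι (Cs a 0 s) κ := by
    apply fx_limit
    intro α' β' hα hβ
    obtain ⟨x, hx, hx2⟩ := exists_lt_of_lt_csSup ⟨0, hS0⟩ hβ
    exact hx.2.mono (cs_mono hα.le hx2.le)
  have hslt : s < 1 := by
    refine lt_of_le_of_ne hs1 fun e => h ?_
    rwa [e] at hsS
  have hR : Fx ι (Cs a s 1) κ := by
    apply fx_limit
    intro α' β' hα hβ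
    rcases lt_or_ge α' 1 with h1 | h1
    · rcases L.dichotomy hV (hs0.trans_lt hα) h1 κ with h2 | h2
      · exact absurd (le_csSup hbd ⟨⟨(hs0.trans_lt hα).le, h1.le⟩, h2⟩) (not_le.2 hα)
      · exact h2.mono (cs_mono le_rfl hβ.le)
    · intro g hg
      have hg' := cs_le_gs _ _ hg
      have : g = 1 := L.ext fun x => by
        rcases le_total x 1 with hx | hx
        · rw [gs_fix_le hg' (hx.trans h1)]; simp
        · rw [gs_fix_ge hg' (hβ.le.trans hx)]; simp
      simp [this]
  have hspos : 0 < s := by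
    refine lt_of_le_of_ne hs0 fun e => h ?_
    rwa [← e] at hR
  exact ⟨⟨s, hspos, hslt⟩, hsS, hR⟩

lemma Loc.not_lt (L : Loc a) {κ : Cantor} (h : ¬ Fx ι (Cs a 0 1) κ) {y y' : ℝ}
    (hy : 0 ≤ y) (hy1 : y' ≤ 1) (hl : Fx ι (Cs a 0 y') κ) (hr : Fx ι (Cs a y 1) κ) : ¬ y < y' := by
  intro hlt
  set S := {x : ℝ | 0 ≤ x ∧ Fx ι (Cs a x 1) κ}
  have hyS : y ∈ S := ⟨hy, hr⟩
  have hbd : BddBelow S := ⟨0, fun x hx => hx.1⟩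
  set t := sInf S
  have ht0 : 0 ≤ t := le_csInf ⟨y, hyS⟩ fun x hx => hx.1
  have hty : t ≤ y := csInf_le hbd hyS
  have htS : Fx ι (Cs a t 1) κ := by
    apply fx_limit
    intro α' β' hα hβ
    obtain ⟨x, hx, hx2⟩ := exists_lt_of_csInf_lt ⟨y, hyS⟩ hα
    exact hx.2.mono (cs_mono hx2.le hβ.le)
  have htpos : 0 < t := by
    refine lt_of_le_of_ne ht0 fun e => h ?_
    rwa [← e] at htS
  have : ∃ g ∈ Cs a 0 y', a g t < t := by
    obtain ⟨g, hg, hgt⟩ := L.cs_moving 0 t y' le_rfl htpos (hty.trans_lt hlt) hy1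
    rcases lt_or_gt_of_ne hgt with h | h
    · exact ⟨g, hg, h⟩
    · exact ⟨g⁻¹, inv_mem hg, L.lt_inv h⟩
  obtain ⟨g, hg, hgt⟩ := this
  have h2 := L.fx_conj htS g
  rw [hl g hg, L.out g 1 (by simp)] at h2
  exact absurd (csInf_le hbd ⟨(L.gs_gt (cs_le_gs _ _ hg) htpos).le, h2⟩) (not_le.2 hgt)

lemma Loc.exists_phi (L : Loc a) (hV : ∀ g, HV (ι g)) :
    ∃ φ : Cantor → OnePoint ↥(Ioo (0 : ℝ) 1),
      (∀ κ, φ κ = OnePoint.infty ↔ Fx ι (Cs a 0 1) κ) ∧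
      (∀ κ (y : Ioo (0 : ℝ) 1), φ κ = OnePoint.some y ↔
        ¬ Fx ι (Cs a 0 1) κ ∧ Fx ι (Cs a 0 y) κ ∧ Fx ι (Cs a y 1) κ) := by
  classical
  refine ⟨fun κ => if h : Fx ι (Cs a 0 1) κ then OnePoint.infty else
    OnePoint.some (L.exists_pt hV h).choose, fun κ => ?_, fun κ y => ?_⟩
  · by_cases h : Fx ι (Cs a 0 1) κ <;> simp [h]
  · by_cases h : Fx ι (Cs a 0 1) κ
    · simp [h]
    · simp only [h, dite_false, not_false_eq_true, true_and]
      obtain ⟨h1, h2⟩ := (L.exists_pt hV h).choose_spec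
      set z := (L.exists_pt hV h).choose
      constructor
      · intro e
        rw [OnePoint.some_eq_iff] at e
        rw [← e]; exact ⟨h1, h2⟩
      · rintro ⟨h3, h4⟩
        congr 1
        apply Subtype.ext
        apply le_antisymm
        · exact _root_.not_lt.1 (L.not_lt h y.2.1.le z.2.2.le h1 h4)
        · exact _root_.not_lt.1 (L.not_lt h z.2.1.le y.2.2.le h3 h2)

lemma Loc.continuous (L : Loc a) (g : Γ) : Continuous (a g) :=
  (L.mono g).continuous_of_surjective (a g).surjective

lemma Loc.mem_Ioo (L : Loc a) (g : Γ) {y : ℝ} (hy : y ∈ Ioo (0 : ℝ) 1) : a g y ∈ Ioo (0 : ℝ) 1 := by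
  have h1 := L.smono g hy.1
  have h2 := L.smono g hy.2
  rw [L.out g 0 (by simp)] at h1
  rw [L.out g 1 (by simp)] at h2
  exact ⟨h1, h2⟩

theorem Loc.main (L : Loc a) (hV : ∀ g, HV (ι g)) (hι : Function.Injective ι) :
    ∃ φ : Cantor → OnePoint ↥(Ioo (0 : ℝ) 1), Continuous φ ∧ Function.Surjective φ ∧
      (∀ g κ, φ κ = OnePoint.infty → φ (ι g κ) = OnePoint.infty) ∧
      (∀ g κ (y z : Ioo (0 : ℝ) 1), φ κ = OnePoint.some y → (z : ℝ) = a g y →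
        φ (ι g κ) = OnePoint.some z) := by
  obtain ⟨φ, hinf, hsome⟩ := L.exists_phi hV
  have e1 : ∀ g κ, φ κ = OnePoint.infty → φ (ι g κ) = OnePoint.infty := by
    intro g κ h
    rw [hinf] at h ⊢
    have := L.fx_conj h g
    rwa [L.out g 0 (by simp), L.out g 1 (by simp)] at this
  have e2 : ∀ g κ (y z : Ioo (0 : ℝ) 1), φ κ = OnePoint.some y → (z : ℝ) = a g y →
        φ (ι g κ) = OnePoint.some z := by
    intro g κ y z h hz
    have h' := h
    rw [hsome] at h ⊢
    obtain ⟨h1, h2, h3⟩ := h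
    refine ⟨fun h4 => ?_, ?_, ?_⟩
    · rw [← hinf] at h4
      have h5 := e1 g⁻¹ _ h4
      have h6 : ι g⁻¹ (ι g κ) = κ := by simp
      rw [h6, h'] at h5
      exact OnePoint.coe_ne_infty _ h5
    · have := L.fx_conj h2 g
      rwa [L.out g 0 (by simp), ← hz] at this
    · have := L.fx_conj h3 g
      rwa [L.out g 1 (by simp), ← hz] at this
  -- a point fixed by `g` has fixed image
  have e3 : ∀ g κ (y : Ioo (0 : ℝ) 1), φ κ = OnePoint.some y → ι g κ = κ → a g y = y := by
    intro g κ y h hg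
    have := e2 g κ y ⟨a g y, L.mem_Ioo g y.2⟩ h rfl
    rw [hg, h, OnePoint.some_eq_iff] at this
    exact (congrArg Subtype.val this).symm
  have hcont : Continuous φ := by
    rw [continuous_iff_continuousAt]
    intro κ
    unfold ContinuousAt
    rcases hκ : φ κ with _ | y
    · change Tendsto φ (𝓝 κ) (𝓝 OnePoint.infty)
      replace hκ : φ κ = OnePoint.infty := hκ
      rw [OnePoint.hasBasis_nhds_infty.tendsto_right_iff]
      rintro K ⟨-, hK⟩
      have hF := (hinf κ).1 hκ
      have key : ∀ᶠ κ' in 𝓝 κ, ∀ y ∈ K, φ κ' ≠ OnePoint.some y := by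
        refine hK.induction_on (p := fun s => ∀ᶠ κ' in 𝓝 κ, ∀ y ∈ s, φ κ' ≠ OnePoint.some y)
          (by simp) ?_ ?_ ?_
        · intro s t hst ht
          filter_upwards [ht] with κ' h y hy using h y (hst hy)
        · intro s t hs ht
          filter_upwards [hs, ht] with κ' h h' y hy
          rcases hy with hy | hy
          · exact h y hy
          · exact h' y hy
        · intro y _
          obtain ⟨g, hg, hgy⟩ := L.cs_moving 0 y 1 le_rfl y.2.1 y.2.2 le_rfl
          have hop : IsOpen {z : Ioo (0 : ℝ) 1 | a g z ≠ z} :=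
            isOpen_ne_fun ((L.continuous g).comp continuous_subtype_val) continuous_subtype_val
          refine ⟨_, mem_nhdsWithin_of_mem_nhds (hop.mem_nhds hgy), ?_⟩
          have hT := L.germ_trivial hV le_rfl zero_lt_one le_rfl hF g hg
          filter_upwards [hT] with κ' hκ' z hz hc
          exact hz (e3 g κ' z hc hκ')
      filter_upwards [key] with κ' h
      rcases h2 : φ κ' with _ | y
      · right; rfl
      · left
        exact ⟨y, fun hy => h y hy h2, rfl⟩
    · change Tendsto φ (𝓝 κ) (𝓝 (OnePoint.some y))
      replace hκ : φ κ = OnePoint.some y := hκ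
      rw [OnePoint.nhds_coe_eq]
      intro U hU
      rw [Filter.mem_map] at hU
      obtain ⟨V, hV', hVU⟩ := mem_nhds_subtype _ _ _ |>.1 hU
      obtain ⟨l, u, hy, hlu⟩ := mem_nhds_iff_exists_Ioo_subset.1
        (Filter.inter_mem hV' (Ioo_mem_nhds y.2.1 y.2.2))
      have hl0 : 0 ≤ max l 0 := le_max_right _ _
      have hu1 : min u 1 ≤ 1 := min_le_right _ _
      have hly : max l 0 < y := max_lt hy.1 y.2.1
      have hyu : (y : ℝ) < min u 1 := lt_min hy.2 y.2.2
      obtain ⟨g, hg, hgy⟩ := L.cs_moving _ y _ hl0 hly hyu hu1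
      have hne : ι g κ ≠ κ := fun h => hgy (e3 g κ y hκ h)
      have hop : IsOpen {κ' | ι g κ' ≠ κ'} := isOpen_ne_fun (hV g).continuous continuous_id
      rw [Filter.mem_map]
      filter_upwards [hop.mem_nhds hne] with κ' hκ'
      rcases h2 : φ κ' with _ | z
      · exact absurd ((hinf κ').1 h2 g (cs_mono hl0 hu1 hg)) hκ'
      · have h3 := (hsome κ' z).1 h2
        have hz1 : max l 0 < (z : ℝ) := by
          by_contra! hc
          exact hκ' (h3.2.2 g (cs_mono hc hu1 hg))
        have hz2 : (z : ℝ) < min u 1 := by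
          by_contra! hc
          exact hκ' (h3.2.1 g (cs_mono hl0 hc hg))
        show φ κ' ∈ U
        rw [h2]
        exact hVU (show (z : ℝ) ∈ V from
          (hlu ⟨(le_max_left _ _).trans_lt hz1, hz2.trans_le (min_le_left _ _)⟩).1)
  refine ⟨φ, hcont, ?_, e1, e2⟩
  have : LocallyCompactSpace (Ioo (0 : ℝ) 1) := isOpen_Ioo.locallyCompactSpace
  have hclosed : IsClosed (Set.range φ) := (isCompact_range hcont).isClosed
  have hSc : IsClosed {y : Ioo (0 : ℝ) 1 | OnePoint.some y ∈ Set.range φ} :=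
    hclosed.preimage OnePoint.continuous_coe
  -- invariance of the image
  have hinvar : ∀ g (y z : Ioo (0 : ℝ) 1), OnePoint.some y ∈ Set.range φ → (z : ℝ) = a g y →
      OnePoint.some z ∈ Set.range φ := by
    rintro g y z ⟨κ, hκ⟩ hz
    exact ⟨ι g κ, e2 g κ y z hκ hz⟩
  have hy0 : ∃ y : Ioo (0 : ℝ) 1, OnePoint.some y ∈ Set.range φ := by
    obtain ⟨g, hg, hgp⟩ := L.cs_moving 0 (1 / 2) 1 le_rfl (by norm_num) (by norm_num) le_rfl
    have : ∃ κ, ι g κ ≠ κ := by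
      by_contra! hc
      have : g = 1 := hι (by rw [map_one]; exact Equiv.ext hc)
      rw [this] at hgp
      simp at hgp
    obtain ⟨κ, hκ⟩ := this
    rcases h2 : φ κ with _ | z
    · exact absurd ((hinf κ).1 h2 g hg) hκ
    · exact ⟨z, κ, h2⟩
  obtain ⟨y, hy⟩ := hy0
  have hall : ∀ z : Ioo (0 : ℝ) 1, OnePoint.some z ∈ Set.range φ := by
    intro z
    by_contra hz
    have hne : z ≠ y := by rintro rfl; exact hz hy
    rcases lt_or_gt_of_ne hne with hlt | hlt
    · set T := {x : ℝ | (z : ℝ) ≤ x ∧ ∃ w : Ioo (0 : ℝ) 1, (w : ℝ) = x ∧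
        OnePoint.some w ∈ Set.range φ}
      have hyT : (y : ℝ) ∈ T := ⟨le_of_lt hlt, y, rfl, hy⟩
      have hbd : BddBelow T := ⟨z, fun x hx => hx.1⟩
      have hp1 : (z : ℝ) ≤ sInf T := le_csInf ⟨_, hyT⟩ fun x hx => hx.1
      have hp2 : sInf T ≤ y := csInf_le hbd hyT
      let p : Ioo (0 : ℝ) 1 := ⟨sInf T, z.2.1.trans_le hp1, hp2.trans_lt y.2.2⟩
      have hpS : OnePoint.some p ∈ Set.range φ := by
        have : p ∈ closure {y : Ioo (0 : ℝ) 1 | OnePoint.some y ∈ Set.range φ} := by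
          rw [closure_subtype]
          refine closure_mono ?_ (csInf_mem_closure ⟨_, hyT⟩ hbd)
          rintro x ⟨-, w, hw, hw'⟩
          exact ⟨w, hw', hw⟩
        rwa [hSc.closure_eq] at this
      have hzp : (z : ℝ) < p := by
        refine lt_of_le_of_ne hp1 fun e => hz ?_
        have : z = p := Subtype.ext e
        rwa [this]
      have : ∃ g ∈ Gs a z 1, a g p < p := by
        obtain ⟨g, hg, hgt⟩ := L.loc z p 1 z.2.1.le hzp p.2.2 le_rfl
        rcases lt_or_gt_of_ne hgt with h | h
        · exact ⟨g, hg, h⟩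
        · exact ⟨g⁻¹, inv_mem hg, L.lt_inv h⟩
      obtain ⟨g, hg, hgp⟩ := this
      have h3 := hinvar g p ⟨a g p, L.mem_Ioo g p.2⟩ hpS rfl
      exact absurd (csInf_le hbd ⟨(L.gs_gt hg hzp).le, _, rfl, h3⟩) (not_le.2 hgp)
    · set T := {x : ℝ | x ≤ (z : ℝ) ∧ ∃ w : Ioo (0 : ℝ) 1, (w : ℝ) = x ∧
        OnePoint.some w ∈ Set.range φ}
      have hyT : (y : ℝ) ∈ T := ⟨le_of_lt hlt, y, rfl, hy⟩
      have hbd : BddAbove T := ⟨z, fun x hx => hx.1⟩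
      have hp1 : sSup T ≤ (z : ℝ) := csSup_le ⟨_, hyT⟩ fun x hx => hx.1
      have hp2 : (y : ℝ) ≤ sSup T := le_csSup hbd hyT
      let p : Ioo (0 : ℝ) 1 := ⟨sSup T, y.2.1.trans_le hp2, hp1.trans_lt z.2.2⟩
      have hpS : OnePoint.some p ∈ Set.range φ := by
        have : p ∈ closure {y : Ioo (0 : ℝ) 1 | OnePoint.some y ∈ Set.range φ} := by
          rw [closure_subtype]
          refine closure_mono ?_ (csSup_mem_closure ⟨_, hyT⟩ hbd)
          rintro x ⟨-, w, hw, hw'⟩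
          exact ⟨w, hw', hw⟩
        rwa [hSc.closure_eq] at this
      have hzp : (p : ℝ) < z := by
        refine lt_of_le_of_ne hp1 fun e => hz ?_
        have : p = z := Subtype.ext e
        rwa [← this]
      have : ∃ g ∈ Gs a 0 z, p < a g p := by
        obtain ⟨g, hg, hgt⟩ := L.loc 0 p z le_rfl p.2.1 hzp z.2.2.le
        rcases lt_or_gt_of_ne hgt with h | h
        · exact ⟨g⁻¹, inv_mem hg, L.inv_lt h⟩
        · exact ⟨g, hg, h⟩
      obtain ⟨g, hg, hgp⟩ := this
      have h3 := hinvar g p ⟨a g p, L.mem_Ioo g p.2⟩ hpS rfl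
      exact absurd (le_csSup hbd ⟨(L.gs_lt hg hzp).le, _, rfl, h3⟩) (not_le.2 hgp)
  haveI : NoncompactSpace (Ioo (0 : ℝ) 1) := by
    rw [← not_compactSpace_iff, ← isCompact_iff_compactSpace, isCompact_Ioo_iff]
    norm_num
  have hdense : DenseRange ((↑) : Ioo (0 : ℝ) 1 → OnePoint (Ioo (0 : ℝ) 1)) :=
    OnePoint.denseRange_coe
  have : closure (Set.range ((↑) : Ioo (0 : ℝ) 1 → OnePoint (Ioo (0 : ℝ) 1))) ⊆ Set.range φ :=
    closure_minimal (by rintro _ ⟨z, rfl⟩; exact hall z) hclosed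
  rw [hdense.closure_range] at this
  exact fun z => this (Set.mem_univ z)

end FnV

namespace FnV

open Set Filter Topology

/-- The bump function. -/
noncomputable def bump (n s ε : ℝ) (x : ℝ) : ℝ :=
  max x (min (s + n * (x - s)) (min (x + (n - 1) * ε) (s + 2 * n * ε + (x - (s + 2 * n * ε)) / n)))

lemma bump_strictMono {n s ε : ℝ} (hn : 2 ≤ n) : StrictMono (bump n s ε) := by
  intro x y h
  unfold bump
  have hn0 : 0 < n := by linarith
  refine max_lt_max h (min_lt_min ?_ (min_lt_min ?_ ?_))
  · have := mul_lt_mul_of_pos_left h hn0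
    linarith
  · linarith
  · have := div_lt_div_of_pos_right (sub_lt_sub_right h (s + 2 * n * ε)) hn0
    linarith

lemma bump_cont {n s ε : ℝ} : Continuous (bump n s ε) := by
  unfold bump
  fun_prop

lemma div_eq_aux {n x s ε : ℝ} (hn : 2 ≤ n) :
    s + 2 * n * ε + (x - (s + 2 * n * ε)) / n = s + 2 * n * ε - 2 * ε + (x - s) / n := by
  field_simp
  ring

lemma bump_left {n s ε x : ℝ} (hn : 2 ≤ n) (hx : x ≤ s) : bump n s ε x = x := by
  unfold bump
  apply max_eq_left
  refine (min_le_left _ _).trans ?_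
  nlinarith

lemma bump_right {n s ε x : ℝ} (hn : 2 ≤ n) (hx : s + 2 * n * ε ≤ x) : bump n s ε x = x := by
  unfold bump
  apply max_eq_left
  refine (min_le_right _ _).trans ((min_le_right _ _).trans ?_)
  have : (x - (s + 2 * n * ε)) / n ≤ x - (s + 2 * n * ε) :=
    div_le_self (by linarith) (by linarith)
  linarith

lemma bump_1 {n s ε x : ℝ} (hn : 2 ≤ n) (hε : 0 < ε) (hx : s ≤ x) (hx' : x ≤ s + ε) :
    bump n s ε x = s + n * (x - s) := by
  unfold bump
  have h1 : s + n * (x - s) ≤ x + (n - 1) * ε := by nlinarith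
  have h2 : x + (n - 1) * ε ≤ s + 2 * n * ε + (x - (s + 2 * n * ε)) / n := by
    rw [div_eq_aux hn]
    have : 0 ≤ (x - s) / n := div_nonneg (by linarith) (by linarith)
    nlinarith
  rw [min_eq_left h2, min_eq_left h1, max_eq_right]
  nlinarith

lemma bump_2 {n s ε x : ℝ} (hn : 2 ≤ n) (hε : 0 < ε) (hx : s + ε ≤ x) (hx' : x ≤ s + n * ε) :
    bump n s ε x = x + (n - 1) * ε := by
  unfold bump
  have h1 : x + (n - 1) * ε ≤ s + n * (x - s) := by nlinarith
  have h2 : x + (n - 1) * ε ≤ s + 2 * n * ε + (x - (s + 2 * n * ε)) / n := by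
    have : x - (s + n * ε) ≤ (x - (s + n * ε)) / n := by
      rw [le_div_iff₀ (by linarith)]
      nlinarith
    have e : (x - (s + 2 * n * ε)) / n = (x - (s + n * ε)) / n - ε := by
      field_simp
      ring
    rw [e]
    linarith
  rw [min_eq_left h2, min_eq_right h1, max_eq_right]
  nlinarith

lemma bump_3 {n s ε x : ℝ} (hn : 2 ≤ n) (hε : 0 < ε) (hx : s + n * ε ≤ x)
    (hx' : x ≤ s + 2 * n * ε) :
    bump n s ε x = s + 2 * n * ε + (x - (s + 2 * n * ε)) / n := by
  unfold bump
  have h0 : (x - (s + n * ε)) / n ≤ x - (s + n * ε) := div_le_self (by linarith) (by linarith)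
  have e : (x - (s + 2 * n * ε)) / n = (x - (s + n * ε)) / n - ε := by
    field_simp
    ring
  have h2 : s + 2 * n * ε + (x - (s + 2 * n * ε)) / n ≤ x + (n - 1) * ε := by
    rw [e]
    linarith
  have h1 : x + (n - 1) * ε ≤ s + n * (x - s) := by nlinarith
  rw [min_eq_right h2, min_eq_right (h2.trans h1), max_eq_right]
  have : x - (s + 2 * n * ε) ≤ (x - (s + 2 * n * ε)) / n := by
    rw [le_div_iff₀ (by linarith)]
    nlinarith
  linarith

lemma bump_surj {n s ε : ℝ} (hn : 2 ≤ n) : Function.Surjective (bump n s ε) := by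
  refine bump_cont.surjective ?_ ?_
  · refine Filter.tendsto_atTop_mono (fun x => ?_) Filter.tendsto_id
    exact le_max_left _ _
  · refine Filter.tendsto_id.congr' ?_
    filter_upwards [Filter.eventually_le_atBot s] with x hx
    exact (bump_left hn hx).symm

/-- The bump as a permutation. -/
noncomputable def bumpP (n s ε : ℝ) (hn : 2 ≤ n) : Equiv.Perm ℝ :=
  Equiv.ofBijective (bump n s ε) ⟨(bump_strictMono hn).injective, bump_surj hn⟩

lemma bumpP_apply (n s ε : ℝ) (hn : 2 ≤ n) (x : ℝ) : bumpP n s ε hn x = bump n s ε x := rfl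

lemma bumpP_isBS (n : ℕ) (hn : (2 : ℝ) ≤ n) (z : ℤ) (k : ℕ)
    (hs : (0 : ℝ) < z / (n : ℝ) ^ k)
    (he : z / (n : ℝ) ^ k + 2 * n * (1 / (n : ℝ) ^ k) < 1) :
    IsBS 0 1 (dyadicLike n) (powersOf n) (bumpP n (z / (n : ℝ) ^ k) (1 / (n : ℝ) ^ k) hn) := by
  have hn0 : (0 : ℝ) < n := by linarith
  have hε : 0 < 1 / (n : ℝ) ^ k := by positivity
  have hA0 : (z : ℝ) / (n : ℝ) ^ k ∈ dyadicLike n := ⟨z, k, rfl⟩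
  have hA1 : (z : ℝ) / (n : ℝ) ^ k + 1 / (n : ℝ) ^ k ∈ dyadicLike n :=
    ⟨z + 1, k, by push_cast; ring⟩
  have hA2 : (z : ℝ) / (n : ℝ) ^ k + n * (1 / (n : ℝ) ^ k) ∈ dyadicLike n :=
    ⟨z + n, k, by push_cast; ring⟩
  have hA3 : (z : ℝ) / (n : ℝ) ^ k + 2 * n * (1 / (n : ℝ) ^ k) ∈ dyadicLike n :=
    ⟨z + 2 * n, k, by push_cast; ring⟩
  have hP0 : (1 : ℝ) ∈ powersOf n := ⟨0, by simp⟩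
  have hP1 : (n : ℝ) ∈ powersOf n := ⟨1, by simp⟩
  have hP2 : (1 / n : ℝ) ∈ powersOf n := ⟨-1, by simp⟩
  generalize (z : ℝ) / (n : ℝ) ^ k = s at *
  generalize 1 / (n : ℝ) ^ k = ε at *
  have hnε : 2 * ε ≤ n * ε := by nlinarith
  have hee : 2 * n * ε = n * ε + n * ε := by ring
  refine ⟨(bump_strictMono hn).monotone, ?_, 5, fun i => match i with
    | 0 => 0
    | 1 => s
    | 2 => s + ε
    | 3 => s + n * ε
    | 4 => s + 2 * n * ε
    | _ => 1, rfl, rfl, ?_, ?_, ?_⟩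
  · intro x hx
    rw [bumpP_apply]
    by_cases h : x ≤ s
    · exact bump_left hn h
    · apply bump_right hn
      by_contra! hc
      exact hx ⟨by linarith, by linarith⟩
  · intro i hi
    interval_cases i <;> simp only [] <;> linarith
  · intro i hi0 hi
    interval_cases i <;> assumption
  · intro i hi
    interval_cases i
    · refine ⟨1, hP0, fun x hx => ?_⟩
      simp only [bumpP_apply, mem_Icc] at hx ⊢
      rw [bump_left hn hx.2, bump_left hn hs.le]
      ring
    · refine ⟨n, hP1, fun x hx => ?_⟩
      simp only [bumpP_apply, mem_Icc] at hx ⊢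
      rw [bump_1 hn hε hx.1 hx.2, bump_left hn le_rfl]
    · refine ⟨1, hP0, fun x hx => ?_⟩
      simp only [bumpP_apply, mem_Icc] at hx ⊢
      rw [bump_2 hn hε hx.1 hx.2, bump_2 hn hε le_rfl (by linarith)]
      ring
    · refine ⟨1 / n, hP2, fun x hx => ?_⟩
      simp only [bumpP_apply, mem_Icc] at hx ⊢
      rw [bump_3 hn hε hx.1 hx.2, bump_3 hn hε le_rfl (by linarith)]
      field_simp
      ring
    · refine ⟨1, hP0, fun x hx => ?_⟩
      simp only [bumpP_apply, mem_Icc] at hx ⊢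
      rw [bump_right hn hx.1, bump_right hn le_rfl]
      ring

lemma isBS_out {A P : Set ℝ} {f : Equiv.Perm ℝ} (h : IsBS 0 1 A P f) (x : ℝ)
    (hx : x ∉ Ioo (0 : ℝ) 1) : f x = x := by
  obtain ⟨hm, ho, -⟩ := h
  have hm' : StrictMono f := hm.strictMono_of_injective f.injective
  by_cases h1 : x ∈ Icc (0 : ℝ) 1
  · have : x = 0 ∨ x = 1 := by
      rcases h1.1.eq_or_lt with h | h
      · exact Or.inl h.symm
      · rcases h1.2.eq_or_lt with h' | h'
        · exact Or.inr h'
        · exact absurd ⟨h, h'⟩ hx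
    obtain ⟨y, hy⟩ := f.surjective x
    by_cases h2 : y ∈ Icc (0 : ℝ) 1
    · rcases this with rfl | rfl
      ·
        have h3 : f 0 ≤ 0 := by rw [← hy]; exact hm (by rw [hy]; exact h2.1)
        by_contra hne
        have h4 : f 0 < 0 := lt_of_le_of_ne h3 hne
        have h5 : f (f 0) = f 0 := ho _ fun h => absurd h.1 (not_le.2 h4)
        exact hne (f.injective h5)
      · have h3 : 1 ≤ f 1 := by
          have := hm h2.2
          rwa [hy] at this
        by_contra hne
        have h4 : 1 < f 1 := lt_of_le_of_ne h3 (Ne.symm hne)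
        have h5 : f (f 1) = f 1 := ho _ fun h => absurd h.2 (not_le.2 h4)
        exact hne (f.injective h5)
    · rw [ho y h2] at hy
      rw [← hy, ho y h2]
  · exact ho x h1

lemma loc_Fn (n : ℕ) (hn : 2 ≤ n) (Fn : Subgroup (Equiv.Perm ℝ))
    (hFn : ∀ f : Equiv.Perm ℝ, f ∈ Fn ↔ IsBS 0 1 (dyadicLike n) (powersOf n) f) :
    Loc Fn.subtype where
  inj := Subtype.val_injective
  mono g := ((hFn g).1 g.2).1
  out g x hx := isBS_out ((hFn g).1 g.2) x hx
  loc := by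
    intro α p β h0 h1 h2 h3
    have hn2 : (2 : ℝ) ≤ n := by exact_mod_cast hn
    have hn0 : (0 : ℝ) < n := by linarith
    have hd : 0 < min (p - α) (β - p) / (4 * n) :=
      div_pos (lt_min (by linarith) (by linarith)) (by positivity)
    obtain ⟨k, hk⟩ := exists_pow_lt_of_lt_one hd (y := 1 / (n : ℝ))
      (by rw [div_lt_one hn0]; linarith)
    rw [one_div_pow, lt_div_iff₀ (by positivity)] at hk
    have hk1 := hk.trans_le (min_le_left _ _)
    have hk2 := hk.trans_le (min_le_right _ _)
    have hpk : 0 < (n : ℝ) ^ k := by positivity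
    have hε : 0 < 1 / (n : ℝ) ^ k := by positivity
    have hεn : 2 * (1 / (n : ℝ) ^ k) ≤ 1 / (n : ℝ) ^ k * n := by nlinarith
    have c1 := Int.ceil_lt_add_one (p * (n : ℝ) ^ k)
    have c2 := Int.le_ceil (p * (n : ℝ) ^ k)
    set z : ℤ := ⌈p * (n : ℝ) ^ k⌉ - 1 with hz
    have d1 : (z : ℝ) / (n : ℝ) ^ k < p := by
      rw [div_lt_iff₀ hpk, hz]; push_cast; linarith
    have d2 : p ≤ (z : ℝ) / (n : ℝ) ^ k + 1 / (n : ℝ) ^ k := by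
      rw [← add_div, le_div_iff₀ hpk, hz]; push_cast; linarith
    have hs : α < (z : ℝ) / (n : ℝ) ^ k := by linarith
    have he : (z : ℝ) / (n : ℝ) ^ k + 2 * n * (1 / (n : ℝ) ^ k) < β := by linarith
    have hB := bumpP_isBS n hn2 z k (by linarith) (by linarith)
    refine ⟨⟨_, (hFn _).2 hB⟩, ⟨_, _, hs, he, ?_⟩, ?_⟩
    · intro x hx
      change bump _ _ _ x = x
      by_cases h : x ≤ (z : ℝ) / (n : ℝ) ^ k
      · exact bump_left hn2 h
      · apply bump_right hn2
        by_contra! hc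
        exact hx ⟨by linarith, hc.le⟩
    · change bump _ _ _ p ≠ p
      rw [bump_1 hn2 hε d1.le d2]
      apply ne_of_gt
      nlinarith

end FnV

/-- **Corollary.** For `n ≥ 2`, every copy of the Brown–Higman–Thompson group `Fₙ` in
Thompson's group `V` is semiconjugate to the standard action of `Fₙ` on the one-point
compactification `Y = (0,1) ∪ {∞}` of the open interval `(0,1)`. -/
theorem Fn_copies_semiconjugate (n : ℕ) (hn : 2 ≤ n)
    (Fn : Subgroup (Equiv.Perm ℝ))
    (hFn : ∀ f : Equiv.Perm ℝ, f ∈ Fn ↔ IsBS 0 1 (dyadicLike n) (powersOf n) f)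
    (ι : ↥Fn →* Equiv.Perm Cantor) (hinj : Function.Injective ι)
    (hV : ∀ f : ↥Fn, InV (ι f)) :
    ∃ φ : Cantor → OnePoint ↥(Set.Ioo (0:ℝ) 1),
      Continuous φ ∧ Function.Surjective φ ∧
      ∀ (f : ↥Fn) (fhat : OnePoint ↥(Set.Ioo (0:ℝ) 1) → OnePoint ↥(Set.Ioo (0:ℝ) 1)),
        fhat OnePoint.infty = OnePoint.infty →
        (∀ y z : ↥(Set.Ioo (0:ℝ) 1), (z : ℝ) = (f : Equiv.Perm ℝ) (y : ℝ) →
          fhat (OnePoint.some y) = OnePoint.some z) →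
        ∀ κ : Cantor, φ ((ι f) κ) = fhat (φ κ) := by
  have L := FnV.loc_Fn n hn Fn hFn
  obtain ⟨φ, hc, hs, e1, e2⟩ := L.main (fun g => FnV.InV.coc (hV g)) hinj
  refine ⟨φ, hc, hs, fun f fhat h1 h2 κ => ?_⟩
  rcases hκ : φ κ with _ | y
  · exact (e1 f κ hκ).trans h1.symm
  · exact (e2 f κ y ⟨_, L.mem_Ioo f y.2⟩ hκ rfl).trans (h2 y _ rfl).symm
end
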